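/- There is a universal constant C > 0 such that for every ε ∈ (0,1), δ ∈ (0,1), β ∈ (0,1), integers d, k, T ≥ 1, and monotone histogram queries q_1,…,q_k with sensitivity 1 on ℕ^d, there exists an (ε,δ)-differentially private (event level) continual-observation mechanism M with input universe {0,1}^d, output space ℝ^k and stream length T such that for every input stream x, with M(x)-probability at least 1 − β, the output sequence (a^1,…,a^T) satisfies |a^t_i − q_i(h^t(x))| ≤ C · ε^{-1} · log(1/δ) · ( √d · log^{3/2}(d·k·c_max(x)/β) + √k · log(k·c_max(x)/β) + log(T/β) ) for all t ≤ T and i ≤ k, where c_max(x) = max_{i ≤ k, t ≤ T} q_i(h^t(x)). -/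

import Mathlib

open MeasureTheory

/-- Base-2 logarithm where the argument is clamped below by 2. -/
noncomputable def log2c (z : ℝ) : ℝ := Real.logb 2 (max z 2)

/-- The histogram of a stream of rows from `{0,1}^d` at time step `t`:
the `i`-th column sum of the first `t+1` rows (time steps are 0-indexed). -/
def hist {d T : ℕ} (x : Fin T → Fin d → Bool) (t : Fin T) (i : Fin d) : ℕ :=
  ∑ s : Fin T, if s ≤ t ∧ x s i then 1 else 0

/-- Two streams differ in at most one time step (event-level neighboring). -/
def EventNeighboring {X : Type*} {T : ℕ} (x y : Fin T → X) : Prop :=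
  ∃ t₀ : Fin T, ∀ s : Fin T, s ≠ t₀ → x s = y s

/-- A continual-observation mechanism: a measurable assignment of output
distributions to input streams whose outputs up to time `t` depend only on the
first `t` inputs. -/
def IsCOMech {X O : Type*} [MeasurableSpace X] [MeasurableSpace O] {T : ℕ}
    (M : (Fin T → X) → Measure (Fin T → O)) : Prop :=
  Measurable M ∧ (∀ x, IsProbabilityMeasure (M x)) ∧
    ∀ (t : Fin T) (x y : Fin T → X), (∀ s, s ≤ t → x s = y s) →
      (M x).map (fun a (s : {s : Fin T // s ≤ t}) => a s.1) =
      (M y).map (fun a (s : {s : Fin T // s ≤ t}) => a s.1)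

/-- `ε`-differential privacy (event level) for a continual-observation mechanism. -/
def IsEventDP {X O : Type*} [MeasurableSpace X] [MeasurableSpace O] {T : ℕ} (ε : ℝ)
    (M : (Fin T → X) → Measure (Fin T → O)) : Prop :=
  ∀ x y, EventNeighboring x y → ∀ S : Set (Fin T → O), MeasurableSet S →
    M x S ≤ ENNReal.ofReal (Real.exp ε) * M y S

/-- `(ε,δ)`-differential privacy (event level) for a continual-observation mechanism. -/
def IsEventDPApprox {X O : Type*} [MeasurableSpace X] [MeasurableSpace O] {T : ℕ}
    (ε δ : ℝ) (M : (Fin T → X) → Measure (Fin T → O)) : Prop :=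
  ∀ x y, EventNeighboring x y → ∀ S : Set (Fin T → O), MeasurableSet S →
    M x S ≤ ENNReal.ofReal (Real.exp ε) * M y S + ENNReal.ofReal δ

/-- A monotone histogram query with sensitivity 1. -/
def MonotoneHistQuery {d : ℕ} (q : (Fin d → ℕ) → ℝ) : Prop :=
  (∀ v, 0 ≤ q v) ∧
  q (fun _ => 0) = 0 ∧
  (∀ v w, (∀ i, v i ≤ w i) → q v ≤ q w) ∧
  (∀ v w : Fin d → ℕ, (∀ i, ((v i : ℤ) - (w i : ℤ)).natAbs ≤ 1) → |q v - q w| ≤ 1)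

/-- The maximum query value attained on the given input at any time step. -/
noncomputable def cmax {d k T : ℕ} (q : Fin k → (Fin d → ℕ) → ℝ)
    (x : Fin T → Fin d → Bool) : ℝ :=
  ⨆ i : Fin k, ⨆ t : Fin T, q i (hist x t)


open MeasureTheory

lemma tree_sum1 (L : ℕ) : ∀ n j : ℕ, j < 2 ^ L →
    (∑ l ∈ Finset.range L, if Odd (j / 2 ^ l) ∧ n / 2 ^ l + 1 = j / 2 ^ l then (1:ℝ) else 0)
      = if n < j then 1 else 0 := by
  induction L with
  | zero => intro n j hj; have : j = 0 := by simpa using hj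
            subst this; simp
  | succ L ih =>
    intro n j hj
    rw [Finset.sum_range_succ']
    have h := ih (n/2) (j/2) (by rw [pow_succ] at hj; omega)
    simp only [pow_succ', ← Nat.div_div_eq_div_mul, pow_zero, Nat.div_one]
    rw [h]
    rcases Nat.even_or_odd' j with ⟨b, hb | hb⟩ <;> rcases Nat.even_or_odd' n with ⟨c, hc | hc⟩ <;>
      subst hb <;> subst hc <;> simp [Nat.odd_iff] <;> split_ifs <;> first | omega | norm_num

noncomputable def s2 (l e : ℕ) : ℝ :=
  if e = 1 then ((l:ℝ)+1)^2 else (Nat.log 2 ((e-1)*2^l) : ℝ) + 1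

lemma s2_pos (l e : ℕ) : 0 < s2 l e := by
  unfold s2; split_ifs <;> positivity

lemma sum_inv_sq (L : ℕ) : ∑ l ∈ Finset.range L, 1/((l:ℝ)+1)^2 ≤ 2 - 1/(L:ℝ) := by
  induction L with
  | zero => norm_num
  | succ L ih =>
    rw [Finset.sum_range_succ]
    rcases Nat.eq_zero_or_pos L with rfl | hL
    · norm_num
    · have hL' : (0:ℝ) < L := by exact_mod_cast hL
      push_cast
      have h : 1/((L:ℝ)+1)^2 ≤ 1/(L:ℝ) - 1/((L:ℝ)+1) := by
        have : 1/(L:ℝ) - 1/((L:ℝ)+1) = 1/((L:ℝ)*((L:ℝ)+1)) := by field_simp; ring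
        rw [this]
        apply one_div_le_one_div_of_le (by positivity)
        nlinarith
      linarith

lemma fin_sum_ite (A a : ℕ) (ha : a < A) (f : ℕ → ℝ) (P : ℕ → Prop) [DecidablePred P] :
    (∑ e : Fin A, if P e.val ∧ a = e.val then f e.val else 0) = if P a then f a else 0 := by
  rw [Finset.sum_eq_single (⟨a, ha⟩ : Fin A)]
  · simp
  · intro b _ hb
    have : a ≠ b.val := fun h => hb (Fin.ext h.symm)
    simp [this]
  · simp

lemma tree (T : ℕ) : ∃ (K : Type) (_ : Fintype K) (D W : ℕ → K → ℝ),
    (∀ n j, n ≤ T → j ≤ T → ∑ κ, D j κ * W n κ = if n < j then 1 else 0) ∧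
    (∀ n, n ≤ T → ∑ κ, W n κ ^ 2 ≤ 3) ∧
    (∀ j, 1 ≤ j → j ≤ T → ∑ κ, D j κ ^ 2 ≤ 2 * ((Nat.log 2 j : ℝ) + 1)^2) := by
  have hT2 : T < 2 ^ (T+2) := lt_of_lt_of_le (Nat.lt_two_pow_self) (Nat.pow_le_pow_right (by norm_num) (by omega))
  refine ⟨Fin (T+2) × Fin (T+2), inferInstance,
    fun j κ => if Odd κ.2.val ∧ j / 2^κ.1.val = κ.2.val then Real.sqrt (s2 κ.1 κ.2) else 0,
    fun n κ => if n / 2^κ.1.val + 1 = κ.2.val then 1 / Real.sqrt (s2 κ.1 κ.2) else 0, ?_, ?_, ?_⟩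
  · intro n j hn hj
    rw [← tree_sum1 (T+2) n j (lt_of_le_of_lt hj hT2), Finset.sum_range, Fintype.sum_prod_type]
    refine Finset.sum_congr rfl fun l _ => ?_
    have hj' : j / 2^l.val < T + 2 := by have := Nat.div_le_self j (2^l.val); omega
    rw [← fin_sum_ite (T+2) (j / 2^l.val) hj' (fun _ => 1) (fun e => Odd e ∧ n / 2^l.val + 1 = e)]
    refine Finset.sum_congr rfl fun e _ => ?_
    have hs := Real.sqrt_pos.2 (s2_pos l.val e.val)
    by_cases h1 : Odd e.val <;> by_cases h2 : j / 2^l.val = e.val <;>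
      by_cases h3 : n / 2^l.val + 1 = e.val <;> simp [h1, h2, h3, hs.ne']
  · intro n hn
    rw [Fintype.sum_prod_type]
    have key : ∀ l : Fin (T+2), (∑ e : Fin (T+2), ((if n / 2^l.val + 1 = e.val then 1 / Real.sqrt (s2 l e) else 0 : ℝ))^2)
        = 1 / s2 l.val (n / 2^l.val + 1) := by
      intro l
      have hj' : n / 2^l.val + 1 < T + 2 := by have := Nat.div_le_self n (2^l.val); omega
      have := fin_sum_ite (T+2) (n / 2^l.val + 1) hj' (fun e => 1 / s2 l.val e) (fun _ => True)
      simp only [true_and, if_true] at this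
      rw [← this]
      refine Finset.sum_congr rfl fun e _ => ?_
      split_ifs
      · rw [div_pow, Real.sq_sqrt (s2_pos _ _).le, one_pow]
      · simp
    simp only [key]
    rw [← Finset.sum_range (fun l => 1 / s2 l (n / 2^l + 1))]
    have hb : ∀ l ∈ Finset.range (T+2), 1 / s2 l (n / 2^l + 1) ≤ 1/((l:ℝ)+1)^2 +
        (if l ∈ Finset.range (Nat.log 2 n + 1) then 1 / ((Nat.log 2 n : ℝ) + 1) else 0) := by
      intro l _
      unfold s2
      by_cases h0 : n / 2^l = 0
      · rw [h0]; simp only [zero_add, if_true]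
        have : (0:ℝ) ≤ (if l ∈ Finset.range (Nat.log 2 n + 1) then 1 / ((Nat.log 2 n : ℝ) + 1) else 0) := by
          split_ifs <;> positivity
        linarith
      · have hn0 : n ≠ 0 := by rintro rfl; simp at h0
        have hle : 2^l ≤ n := by
          by_contra hc; exact h0 (Nat.div_eq_of_lt (not_le.1 hc))
        have hll : l ≤ Nat.log 2 n := Nat.le_log_of_pow_le (by norm_num) hle
        rw [if_neg (by omega), if_pos (by simp; omega)]
        have : Nat.log 2 ((n / 2^l + 1 - 1) * 2^l) = Nat.log 2 n := by
          rw [Nat.add_sub_cancel]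
          apply le_antisymm
          · exact Nat.log_mono_right (Nat.div_mul_le_self _ _)
          · apply Nat.le_log_of_pow_le (by norm_num)
            have h5 : 2 ^ Nat.log 2 n = 2 ^ (Nat.log 2 n - l) * 2 ^ l := by
              rw [← pow_add]; congr 1; omega
            rw [h5]
            apply Nat.mul_le_mul_right
            rw [Nat.le_div_iff_mul_le (by positivity), ← h5]
            exact Nat.pow_log_le_self 2 hn0
        rw [this]
        have : (0:ℝ) ≤ 1/((l:ℝ)+1)^2 := by positivity
        linarith
    refine (Finset.sum_le_sum hb).trans ?_
    rw [Finset.sum_add_distrib]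
    have h1 := sum_inv_sq (T+2)
    have h2 : (∑ l ∈ Finset.range (T+2), (if l ∈ Finset.range (Nat.log 2 n + 1) then 1 / ((Nat.log 2 n : ℝ) + 1) else 0)) ≤ 1 := by
      rw [← Finset.sum_filter]
      calc _ ≤ ∑ l ∈ Finset.range (Nat.log 2 n + 1), 1 / ((Nat.log 2 n : ℝ) + 1) := by
            apply Finset.sum_le_sum_of_subset_of_nonneg
            · intro a ha; exact (Finset.mem_filter.1 ha).2
            · intros; positivity
        _ = 1 := by
            rw [Finset.sum_const, Finset.card_range, nsmul_eq_mul]; push_cast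
            field_simp
    have h3 : (0:ℝ) ≤ 1/((T+2:ℕ):ℝ) := by positivity
    linarith
  · intro j hj1 hj
    rw [Fintype.sum_prod_type]
    have key : ∀ l : Fin (T+2), (∑ e : Fin (T+2), ((if Odd e.val ∧ j / 2^l.val = e.val then Real.sqrt (s2 l e) else 0 : ℝ))^2)
        = if Odd (j / 2^l.val) then s2 l.val (j / 2^l.val) else 0 := by
      intro l
      have hj' : j / 2^l.val < T + 2 := by have := Nat.div_le_self j (2^l.val); omega
      rw [← fin_sum_ite (T+2) (j / 2^l.val) hj' (fun e => s2 l.val e) (fun e => Odd e)]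
      refine Finset.sum_congr rfl fun e _ => ?_
      split_ifs
      · rw [Real.sq_sqrt (s2_pos _ _).le]
      · simp
    simp only [key]
    rw [← Finset.sum_range (fun l => if Odd (j / 2^l) then s2 l (j / 2^l) else 0)]
    have hb : ∀ l ∈ Finset.range (T+2), (if Odd (j / 2^l) then s2 l (j / 2^l) else 0) ≤
        (if l = Nat.log 2 j then ((Nat.log 2 j : ℝ) + 1)^2 else 0) +
        (if l ∈ Finset.range (Nat.log 2 j + 1) then ((Nat.log 2 j : ℝ) + 1) else 0) := by
      intro l _
      have hp1 : (0:ℝ) ≤ (if l = Nat.log 2 j then ((Nat.log 2 j : ℝ) + 1)^2 else 0) := by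
        split_ifs <;> positivity
      have hp2 : (0:ℝ) ≤ (if l ∈ Finset.range (Nat.log 2 j + 1) then ((Nat.log 2 j : ℝ) + 1) else 0) := by
        split_ifs <;> positivity
      by_cases h0 : Odd (j / 2^l)
      · rw [if_pos h0]
        have hj0 : j / 2^l ≠ 0 := by intro h; rw [h] at h0; simp at h0
        have hle : 2^l ≤ j := by
          by_contra hc; exact hj0 (Nat.div_eq_of_lt (not_le.1 hc))
        have hll : l ≤ Nat.log 2 j := Nat.le_log_of_pow_le (by norm_num) hle
        unfold s2
        by_cases h1 : j / 2^l = 1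
        · have : l = Nat.log 2 j := by
            apply le_antisymm hll
            have : j < 2^(l+1) := by
              rw [pow_succ]
              have := Nat.div_add_mod j (2^l)
              rw [h1] at this
              have := Nat.mod_lt j (show 0 < 2^l by positivity)
              omega
            exact Nat.lt_succ_iff.1 (Nat.log_lt_of_lt_pow (by omega) this)
          rw [if_pos h1, if_pos this]
          rw [← this] at hp2 ⊢
          linarith
        · rw [if_neg h1]
          rw [if_pos (by simp; omega : l ∈ Finset.range (Nat.log 2 j + 1))]
          have : Nat.log 2 ((j / 2 ^ l - 1) * 2 ^ l) ≤ Nat.log 2 j := by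
            apply Nat.log_mono_right
            calc (j / 2 ^ l - 1) * 2 ^ l ≤ (j / 2 ^ l) * 2 ^ l := Nat.mul_le_mul_right _ (Nat.sub_le _ _)
              _ ≤ j := Nat.div_mul_le_self _ _
          have : (Nat.log 2 ((j / 2 ^ l - 1) * 2 ^ l) : ℝ) ≤ Nat.log 2 j := by exact_mod_cast this
          linarith
      · rw [if_neg h0]; linarith
    refine (Finset.sum_le_sum hb).trans ?_
    rw [Finset.sum_add_distrib]
    have h1 : (∑ l ∈ Finset.range (T+2), (if l = Nat.log 2 j then ((Nat.log 2 j : ℝ) + 1)^2 else 0)) ≤ ((Nat.log 2 j : ℝ) + 1)^2 := by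
      rw [Finset.sum_ite_eq']
      split_ifs
      · exact le_rfl
      · positivity
    have h2 : (∑ l ∈ Finset.range (T+2), (if l ∈ Finset.range (Nat.log 2 j + 1) then ((Nat.log 2 j : ℝ) + 1) else 0)) ≤ ((Nat.log 2 j : ℝ) + 1)^2 := by
      rw [← Finset.sum_filter]
      calc _ ≤ ∑ l ∈ Finset.range (Nat.log 2 j + 1), ((Nat.log 2 j : ℝ) + 1) := by
            apply Finset.sum_le_sum_of_subset_of_nonneg
            · intro a ha; exact (Finset.mem_filter.1 ha).2
            · intros; positivity
        _ = _ := by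
            rw [Finset.sum_const, Finset.card_range, nsmul_eq_mul]; push_cast
            ring
    linarith

open MeasureTheory

section gauss
variable {ι : Type} [Fintype ι]

noncomputable def gd (ω : ι → ℝ) : ENNReal := ENNReal.ofReal (Real.exp (-(∑ i, ω i ^ 2) / 2))

noncomputable def gm (ι : Type) [Fintype ι] : Measure (ι → ℝ) :=
  (∫⁻ ω : ι → ℝ, gd ω)⁻¹ • (volume.withDensity gd)

lemma gd_meas : Measurable (gd : (ι → ℝ) → ENNReal) := by
  unfold gd; fun_prop

lemma gd_pos (ω : ι → ℝ) : 0 < gd ω := by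
  unfold gd; simp [Real.exp_pos]

lemma gd_int_ne_top : (∫⁻ ω : ι → ℝ, gd ω) ≠ ⊤ := by
  have h1 : Integrable (fun x : ℝ => Real.exp (-(1/2) * x ^ 2)) := integrable_exp_neg_mul_sq (by norm_num)
  have h2 : Integrable (fun ω : ι → ℝ => ∏ i, Real.exp (-(1/2) * ω i ^ 2)) :=
    Integrable.fintype_prod (f := fun _ x => Real.exp (-(1/2) * x ^ 2)) (fun _ => h1)
  have h3 := h2.lintegral_lt_top
  refine ne_of_lt (lt_of_eq_of_lt ?_ h3)
  refine lintegral_congr fun ω => ?_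
  unfold gd
  rw [← Real.exp_sum, ← Finset.mul_sum]
  congr 2; ring

lemma gd_int_ne_zero : (∫⁻ ω : ι → ℝ, gd ω) ≠ 0 := by
  rw [Ne, lintegral_eq_zero_iff gd_meas]
  intro h
  have h0 : ∀ᵐ ω : ι → ℝ, False := by
    filter_upwards [h] with ω hω
    exact (gd_pos ω).ne' hω
  have : (volume : Measure (ι → ℝ)) Set.univ = 0 := by
    simpa using h0
  exact (NeZero.ne (volume : Measure (ι → ℝ))) (Measure.measure_univ_eq_zero.1 this)

instance : IsProbabilityMeasure (gm ι) := by
  constructor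
  unfold gm
  simp only [Measure.smul_apply, smul_eq_mul, withDensity_apply _ MeasurableSet.univ, Measure.restrict_univ]
  exact ENNReal.inv_mul_cancel gd_int_ne_zero gd_int_ne_top

lemma gm_lint (f : (ι → ℝ) → ENNReal) (hf : Measurable f) :
    ∫⁻ ω, f ω ∂(gm ι) = (∫⁻ ω : ι → ℝ, gd ω)⁻¹ * ∫⁻ ω, gd ω * f ω := by
  unfold gm
  rw [lintegral_smul_measure, lintegral_withDensity_eq_lintegral_mul _ gd_meas hf]
  rfl

noncomputable def dotp (w ω : ι → ℝ) : ℝ := ∑ i, w i * ω i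

lemma dotp_meas (w : ι → ℝ) : Measurable (dotp w) := by unfold dotp; fun_prop

lemma gm_shift (f : (ι → ℝ) → ENNReal) (hf : Measurable f) (w : ι → ℝ) :
    ∫⁻ ω, f (ω + w) ∂(gm ι) =
      ∫⁻ ω, ENNReal.ofReal (Real.exp (dotp w ω - dotp w w / 2)) * f ω ∂(gm ι) := by
  have hm : Measurable fun ω : ι → ℝ => ENNReal.ofReal (Real.exp (dotp w ω - dotp w w / 2)) := by
    have := dotp_meas w
    fun_prop
  rw [gm_lint _ (by fun_prop), gm_lint _ (by fun_prop)]
  congr 1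
  refine Eq.trans ?_ (lintegral_add_right_eq_self (μ := (volume : Measure (ι → ℝ)))
    (fun ω => gd ω * (ENNReal.ofReal (Real.exp (dotp w ω - dotp w w / 2)) * f ω)) w)
  refine lintegral_congr fun ω => ?_
  rw [← mul_assoc]
  congr 1
  unfold gd
  rw [← ENNReal.ofReal_mul (Real.exp_pos _).le, ← Real.exp_add]
  congr 2
  have h1 : ∑ i, (ω + w) i ^ 2 = ∑ i, ω i ^ 2 + 2 * ∑ i, w i * ω i + ∑ i, w i * w i := by
    rw [Finset.mul_sum, ← Finset.sum_add_distrib, ← Finset.sum_add_distrib]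
    refine Finset.sum_congr rfl fun i _ => ?_
    simp only [Pi.add_apply]; ring
  have h2 : ∑ i, w i * (ω + w) i = ∑ i, w i * ω i + ∑ i, w i * w i := by
    rw [← Finset.sum_add_distrib]
    refine Finset.sum_congr rfl fun i _ => ?_
    simp only [Pi.add_apply]; ring
  unfold dotp
  rw [h1, h2]; ring

lemma gm_mgf (w : ι → ℝ) (A : Set (ι → ℝ)) (hA : MeasurableSet A) (r : ℝ)
    (hinv : ∀ ω, ω + r • w ∈ A ↔ ω ∈ A) :
    ∫⁻ ω in A, ENNReal.ofReal (Real.exp (r * dotp w ω)) ∂(gm ι)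
      = ENNReal.ofReal (Real.exp (r^2 * dotp w w / 2)) * gm ι A := by
  have hm : Measurable fun ω : ι → ℝ => ENNReal.ofReal (Real.exp (r * dotp w ω)) := by
    have := dotp_meas w
    fun_prop
  have h := gm_shift (A.indicator 1) (measurable_one.indicator hA) (r • w)
  have h1 : ∀ ω, (A.indicator 1 (ω + r • w) : ENNReal) = A.indicator 1 ω := by
    intro ω; by_cases hω : ω ∈ A
    · rw [Set.indicator_of_mem hω, Set.indicator_of_mem ((hinv ω).2 hω)]; rfl
    · rw [Set.indicator_of_notMem hω, Set.indicator_of_notMem (fun h => hω ((hinv ω).1 h))]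
  simp only [h1] at h
  rw [lintegral_indicator_one hA] at h
  rw [h, ← lintegral_const_mul _ (by
    have := dotp_meas (r • w)
    have := (measurable_one (α := ENNReal) (β := ι → ℝ)).indicator hA
    fun_prop), ← lintegral_indicator hA]
  refine lintegral_congr fun ω => ?_
  by_cases hω : ω ∈ A
  · rw [Set.indicator_of_mem hω, Set.indicator_of_mem hω, Pi.one_apply, mul_one,
      ← ENNReal.ofReal_mul (Real.exp_pos _).le, ← Real.exp_add]
    congr 2
    have e1 : dotp (r • w) ω = r * dotp w ω := by
      unfold dotp; rw [Finset.mul_sum]; refine Finset.sum_congr rfl fun i _ => ?_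
      simp only [Pi.smul_apply, smul_eq_mul]; ring
    have e2 : dotp (r • w) (r • w) = r^2 * dotp w w := by
      unfold dotp; rw [Finset.mul_sum]; refine Finset.sum_congr rfl fun i _ => ?_
      simp only [Pi.smul_apply, smul_eq_mul]; ring
    rw [e1, e2]; ring
  · rw [Set.indicator_of_notMem hω, Set.indicator_of_notMem hω]; simp

lemma gm_priv (w : ι → ℝ) (A D : Set (ι → ℝ)) (hA : MeasurableSet A) (hD : MeasurableSet D)
    (hDA : D ⊆ A) (e s : ℝ) (hs : 0 ≤ s)
    (hinv : ∀ r : ℝ, ∀ ω, ω + r • w ∈ A ↔ ω ∈ A) :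
    gm ι {ω | ω + w ∈ D} ≤ ENNReal.ofReal (Real.exp e) * gm ι D +
      ENNReal.ofReal (Real.exp (-s*e + s*(1+s)*dotp w w/2)) * gm ι A := by
  have hd := dotp_meas w
  have h := gm_shift (D.indicator 1) (measurable_one.indicator hD) w
  have h1 : ∀ ω, (D.indicator 1 (ω + w) : ENNReal) = {ω | ω + w ∈ D}.indicator 1 ω := fun ω => rfl
  simp only [h1] at h
  rw [lintegral_indicator_one (show MeasurableSet {ω | ω + w ∈ D} from hD.preimage (f := fun ω => ω + w) (by fun_prop))] at h
  rw [h]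
  have hm := gm_mgf w A hA (1+s) (hinv (1+s))
  calc _ ≤ ∫⁻ ω, (ENNReal.ofReal (Real.exp e) * D.indicator 1 ω +
        ENNReal.ofReal (Real.exp (-s*e - (1+s)*dotp w w/2)) *
          A.indicator (fun ω => ENNReal.ofReal (Real.exp ((1+s) * dotp w ω))) ω) ∂(gm ι) := by
        refine lintegral_mono fun ω => ?_
        by_cases hω : ω ∈ D
        · rw [Set.indicator_of_mem hω, Set.indicator_of_mem (hDA hω), Pi.one_apply, mul_one, mul_one,
            ← ENNReal.ofReal_mul (Real.exp_pos _).le, ← Real.exp_add,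
            ← ENNReal.ofReal_add (Real.exp_pos _).le (Real.exp_pos _).le]
          apply ENNReal.ofReal_le_ofReal
          by_cases hL : dotp w ω - dotp w w / 2 ≤ e
          · have := Real.exp_le_exp.2 hL
            have := Real.exp_pos (-s*e - (1+s)*dotp w w/2 + (1+s) * dotp w ω)
            linarith
          · have : dotp w ω - dotp w w / 2 ≤ -s*e - (1+s)*dotp w w/2 + (1+s) * dotp w ω := by
              push Not at hL
              nlinarith
            have := Real.exp_le_exp.2 this
            have := Real.exp_pos e
            linarith
        · rw [Set.indicator_of_notMem hω]; simp
    _ = _ := by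
        rw [lintegral_add_left ((measurable_one.indicator hD).const_mul _), lintegral_const_mul _ (measurable_one.indicator hD),
          lintegral_indicator_one hD, lintegral_const_mul _ (Measurable.indicator (by fun_prop) hA),
          lintegral_indicator hA, hm, ← mul_assoc, ← ENNReal.ofReal_mul (Real.exp_pos _).le, ← Real.exp_add]
        congr 4
        ring

lemma gm_tail (w : ι → ℝ) (V r : ℝ) (hV : 0 < V) (hw : dotp w w ≤ V) (hr : 0 ≤ r) :
    gm ι {ω | r < |dotp w ω|} ≤ 2 * ENNReal.ofReal (Real.exp (-(r^2/(2*V)))) := by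
  have key : ∀ s : ℝ, s^2 = 1 → gm ι {ω | r < s * dotp w ω} ≤ ENNReal.ofReal (Real.exp (-(r^2/(2*V)))) := by
    intro s hs
    have hm := gm_mgf w Set.univ MeasurableSet.univ (s * (r/V)) (by simp)
    rw [Measure.restrict_univ, measure_univ, mul_one] at hm
    have hd := dotp_meas w
    have hset : MeasurableSet {ω : ι → ℝ | r < s * dotp w ω} :=
      measurableSet_lt measurable_const (by fun_prop)
    rw [← lintegral_indicator_one hset]
    calc _ ≤ ∫⁻ ω, ENNReal.ofReal (Real.exp (-(r^2/V))) * ENNReal.ofReal (Real.exp (s * (r/V) * dotp w ω)) ∂(gm ι) := by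
          refine lintegral_mono fun ω => ?_
          by_cases hω : ω ∈ {ω : ι → ℝ | r < s * dotp w ω}
          · rw [Set.indicator_of_mem hω, Pi.one_apply, ← ENNReal.ofReal_mul (Real.exp_pos _).le, ← Real.exp_add,
              ← ENNReal.ofReal_one]
            apply ENNReal.ofReal_le_ofReal
            apply Real.one_le_exp
            have hω' : r < s * dotp w ω := hω
            have : r/V * r ≤ r/V * (s * dotp w ω) := mul_le_mul_of_nonneg_left hω'.le (by positivity)
            have e : r^2/V = r/V*r := by ring
            rw [e]; nlinarith
          · rw [Set.indicator_of_notMem hω]; simp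
      _ ≤ _ := by
          rw [lintegral_const_mul _ (by fun_prop), hm, ← ENNReal.ofReal_mul (Real.exp_pos _).le, ← Real.exp_add]
          apply ENNReal.ofReal_le_ofReal
          apply Real.exp_le_exp.2
          have : (s*(r/V))^2 * dotp w w / 2 ≤ (s*(r/V))^2 * V / 2 := by gcongr
          have e : (s*(r/V))^2 * V / 2 = r^2/(2*V) := by
            rw [mul_pow, hs]; field_simp
          have e2 : r^2/V = 2 * (r^2/(2*V)) := by field_simp
          linarith
  have hsub : {ω : ι → ℝ | r < |dotp w ω|} ⊆ {ω | r < 1 * dotp w ω} ∪ {ω | r < (-1) * dotp w ω} := by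
    intro ω hω
    have hω' : r < |dotp w ω| := hω
    rcases lt_abs.1 hω' with h | h
    · left; simpa using h
    · right; simpa using h
  refine (measure_mono hsub).trans ((measure_union_le _ _).trans ?_)
  rw [two_mul]
  exact add_le_add (key 1 (by norm_num)) (key (-1) (by norm_num))
end gauss

open MeasureTheory

structure Par (d k : ℕ) (K : Type) where
  q : Fin k → (Fin d → ℕ) → ℝ
  e1 : ℝ
  sg : ℝ
  Dl : ℕ → ℝ
  D : ℕ → K → ℝ

abbrev Sta (d : ℕ) := ℕ × ℕ × (Fin d → ℕ)

section mech
set_option linter.all false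
variable {d k T : ℕ} {K : Type} [Fintype K]

def cnt (x : Fin T → Fin d → Bool) (s t : ℕ) (c : Fin d) : ℕ :=
  ∑ r : Fin T, if s ≤ r.val ∧ r.val < t ∧ x r c then 1 else 0

noncomputable def Nz (p : Par d k K) (j : ℕ) (ω : Fin d × K → ℝ) (c : Fin d) : ℝ :=
  ∑ κ, p.D j κ * ω (c, κ)

noncomputable def Fq (p : Par d k K) (x : Fin T → Fin d → Bool) (s : ℕ) (g : Fin d → ℕ) (r : ℕ) : ℝ :=
  ⨆ i : Fin k, (p.q i (fun c => g c + cnt x s r c) - p.q i g)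

noncomputable def hz (p : Par d k K) (x : Fin T → Fin d → Bool) (σ : Sta d) (r : ℕ) : ℝ :=
  Real.exp (p.e1 * (Fq p x σ.2.1 σ.2.2 (r+1) - p.Dl σ.1))

noncomputable def Hz (p : Par d k K) (x : Fin T → Fin d → Bool) (σ : Sta d) (t : ℕ) : ℝ :=
  ∑ r ∈ Finset.Ico σ.2.1 t, hz p x σ r

noncomputable def Gz (p : Par d k K) (x : Fin T → Fin d → Bool) (σ : Sta d) (t : ℕ) : ℝ :=
  1 / (1 + Hz p x σ t)

noncomputable def stp (p : Par d k K) (x : Fin T → Fin d → Bool) (U : Fin (T+1) → ℝ)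
    (ω : Fin d × K → ℝ) (t : ℕ) (σ : Sta d) : Sta d :=
  if Gz p x σ (t+1) ≤ U (Fin.ofNat (T+1) σ.1) then
    (σ.1 + 1, t + 1, fun c => ⌊(cnt x 0 (t+1) c : ℝ) + p.sg * Nz p (σ.1+1) ω c⌋₊)
  else σ

noncomputable def st (p : Par d k K) (x : Fin T → Fin d → Bool) (U : Fin (T+1) → ℝ)
    (ω : Fin d × K → ℝ) : ℕ → Sta d
  | 0 => (0, 0, fun _ => 0)
  | t+1 => stp p x U ω t (st p x U ω t)

lemma cnt_congr (x y : Fin T → Fin d → Bool) (s t : ℕ)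
    (h : ∀ r : Fin T, s ≤ r.val → r.val < t → x r = y r) : cnt x s t = cnt y s t := by
  funext c
  unfold cnt
  refine Finset.sum_congr rfl fun r _ => ?_
  by_cases h1 : s ≤ r.val <;> by_cases h2 : r.val < t
  · rw [h r h1 h2]
  all_goals simp [h1, h2]

lemma cnt_add (x : Fin T → Fin d → Bool) (s t : ℕ) (h : s ≤ t) (c : Fin d) :
    cnt x 0 s c + cnt x s t c = cnt x 0 t c := by
  unfold cnt
  rw [← Finset.sum_add_distrib]
  refine Finset.sum_congr rfl fun r _ => ?_
  by_cases h1 : r.val < s <;> by_cases h2 : r.val < t <;> by_cases h3 : x r c = true <;>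
    simp [h1, h2, h3] <;> omega

lemma cnt_mono (x : Fin T → Fin d → Bool) (s t t' : ℕ) (h : t ≤ t') (c : Fin d) :
    cnt x s t c ≤ cnt x s t' c := by
  unfold cnt
  refine Finset.sum_le_sum fun r _ => ?_
  split_ifs with h1 h2 <;> first | omega | (exfalso; exact h2 ⟨h1.1, by omega, h1.2.2⟩)

lemma cnt_self (x : Fin T → Fin d → Bool) (s : ℕ) (c : Fin d) : cnt x s s c = 0 := by
  unfold cnt
  refine Finset.sum_eq_zero fun r _ => ?_
  rw [if_neg]; omega

lemma hist_eq (x : Fin T → Fin d → Bool) (t : Fin T) : hist x t = cnt x 0 (t.val+1) := by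
  funext c; unfold hist cnt
  refine Finset.sum_congr rfl fun r _ => ?_
  have h : r ≤ t ↔ r.val < t.val + 1 := by rw [Fin.le_def]; omega
  simp only [h, Nat.zero_le, true_and]

def vdiff (x y : Fin T → Fin d → Bool) (t₀ : Fin T) (c : Fin d) : ℤ :=
  (if x t₀ c then 1 else 0) - (if y t₀ c then 1 else 0)

lemma cnt_diff (x y : Fin T → Fin d → Bool) (t₀ : Fin T) (hxy : ∀ r, r ≠ t₀ → x r = y r)
    (s t : ℕ) (c : Fin d) :
    (cnt x s t c : ℤ) - cnt y s t c = if s ≤ t₀.val ∧ t₀.val < t then vdiff x y t₀ c else 0 := by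
  unfold cnt
  push_cast
  rw [← Finset.sum_sub_distrib, Finset.sum_eq_single t₀]
  · unfold vdiff
    by_cases h1 : s ≤ t₀.val <;> by_cases h2 : t₀.val < t <;> simp [h1, h2]
  · intro b _ hb
    rw [hxy b hb]; simp
  · simp

lemma vdiff_abs (x y : Fin T → Fin d → Bool) (t₀ : Fin T) (c : Fin d) : (vdiff x y t₀ c).natAbs ≤ 1 := by
  unfold vdiff; split_ifs <;> simp

lemma cnt_near (x y : Fin T → Fin d → Bool) (t₀ : Fin T) (hxy : ∀ r, r ≠ t₀ → x r = y r)
    (s t : ℕ) (c : Fin d) : ((cnt x s t c : ℤ) - cnt y s t c).natAbs ≤ 1 := by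
  rw [cnt_diff x y t₀ hxy]
  split_ifs
  · exact vdiff_abs x y t₀ c
  · simp

lemma le_Fq (p : Par d k K) (x : Fin T → Fin d → Bool) (s : ℕ) (g : Fin d → ℕ) (r : ℕ) (i : Fin k) :
    p.q i (fun c => g c + cnt x s r c) - p.q i g ≤ Fq p x s g r :=
  le_ciSup (f := fun i => p.q i (fun c => g c + cnt x s r c) - p.q i g) (Set.finite_range _).bddAbove i

lemma Fq_near (hk : 1 ≤ k) (p : Par d k K) (hq : ∀ i, MonotoneHistQuery (p.q i))
    (x y : Fin T → Fin d → Bool) (t₀ : Fin T) (hxy : ∀ r, r ≠ t₀ → x r = y r)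
    (s : ℕ) (g : Fin d → ℕ) (r : ℕ) : Fq p x s g r ≤ Fq p y s g r + 1 := by
  haveI : Nonempty (Fin k) := ⟨⟨0, hk⟩⟩
  refine ciSup_le fun i => ?_
  have h1 := le_Fq p y s g r i
  have h2 := (hq i).2.2.2 (fun c => g c + cnt x s r c) (fun c => g c + cnt y s r c) (by
    intro c
    have := cnt_near x y t₀ hxy s r c
    push_cast
    omega)
  have := abs_le.1 h2
  linarith

lemma hz_pos (p : Par d k K) (x : Fin T → Fin d → Bool) (σ : Sta d) (r : ℕ) : 0 < hz p x σ r :=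
  Real.exp_pos _

lemma Hz_nonneg (p : Par d k K) (x : Fin T → Fin d → Bool) (σ : Sta d) (r : ℕ) : 0 ≤ Hz p x σ r :=
  Finset.sum_nonneg fun _ _ => (hz_pos _ _ _ _).le

lemma Hz_mono (p : Par d k K) (x : Fin T → Fin d → Bool) (σ : Sta d) {r r' : ℕ} (h : r ≤ r') :
    Hz p x σ r ≤ Hz p x σ r' :=
  Finset.sum_le_sum_of_subset_of_nonneg (Finset.Ico_subset_Ico_right h) fun _ _ _ => (hz_pos _ _ _ _).le

lemma Gz_anti (p : Par d k K) (x : Fin T → Fin d → Bool) (σ : Sta d) {r r' : ℕ} (h : r ≤ r') :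
    Gz p x σ r' ≤ Gz p x σ r := by
  have := Hz_mono p x σ h
  have := Hz_nonneg p x σ r
  exact one_div_le_one_div_of_le (by linarith) (by linarith)

lemma Gz_pos (p : Par d k K) (x : Fin T → Fin d → Bool) (σ : Sta d) (r : ℕ) : 0 < Gz p x σ r := by
  have := Hz_nonneg p x σ r
  unfold Gz; positivity

lemma Gz_le_one (p : Par d k K) (x : Fin T → Fin d → Bool) (σ : Sta d) (r : ℕ) : Gz p x σ r ≤ 1 := by
  have := Hz_nonneg p x σ r
  unfold Gz
  rw [div_le_one (by linarith)]; linarith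

lemma Gz_self (p : Par d k K) (x : Fin T → Fin d → Bool) (σ : Sta d) : Gz p x σ σ.2.1 = 1 := by
  simp [Gz, Hz]

lemma hz_congr (p : Par d k K) (x y : Fin T → Fin d → Bool) (σ : Sta d) (t : ℕ)
    (h : ∀ r : Fin T, σ.2.1 ≤ r.val → r.val < t → x r = y r) {r : ℕ} (hr : r < t) : hz p x σ r = hz p y σ r := by
  unfold hz Fq
  rw [cnt_congr x y σ.2.1 (r+1) (fun r' h1 h2 => h r' h1 (by omega))]

lemma Gz_congr (p : Par d k K) (x y : Fin T → Fin d → Bool) (σ : Sta d) (t : ℕ)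
    (h : ∀ r : Fin T, σ.2.1 ≤ r.val → r.val < t → x r = y r) : Gz p x σ t = Gz p y σ t := by
  unfold Gz Hz
  congr 2
  refine Finset.sum_congr rfl fun r hr => hz_congr p x y σ t h (Finset.mem_Ico.1 hr).2

lemma hz_near (hk : 1 ≤ k) (p : Par d k K) (he : 0 ≤ p.e1) (hq : ∀ i, MonotoneHistQuery (p.q i))
    (x y : Fin T → Fin d → Bool) (t₀ : Fin T) (hxy : ∀ r, r ≠ t₀ → x r = y r) (σ : Sta d) (r : ℕ) :
    hz p x σ r ≤ Real.exp p.e1 * hz p y σ r := by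
  unfold hz
  rw [← Real.exp_add]
  apply Real.exp_le_exp.2
  have := Fq_near hk p hq x y t₀ hxy σ.2.1 σ.2.2 (r+1)
  nlinarith

lemma Hz_near (hk : 1 ≤ k) (p : Par d k K) (he : 0 ≤ p.e1) (hq : ∀ i, MonotoneHistQuery (p.q i))
    (x y : Fin T → Fin d → Bool) (t₀ : Fin T) (hxy : ∀ r, r ≠ t₀ → x r = y r) (σ : Sta d) (t : ℕ) :
    Hz p x σ t ≤ Real.exp p.e1 * Hz p y σ t := by
  unfold Hz
  rw [Finset.mul_sum]
  exact Finset.sum_le_sum fun r _ => hz_near hk p he hq x y t₀ hxy σ r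

lemma ratio_aux (E a b a' b' : ℝ) (hE : 1 ≤ E) (ha : 0 ≤ a) (hb : 0 ≤ b) (ha' : 0 ≤ a') (hb' : 0 ≤ b')
    (h1 : a' ≤ E * a) (h2 : b ≤ E * b') (h3 : b' ≤ E * b) :
    1/(1+a) - 1/(1+(a+b)) ≤ E^3 * (1/(1+a') - 1/(1+(a'+b'))) := by
  have e1 : 1/(1+a) - 1/(1+(a+b)) = b / ((1+a)*(1+(a+b))) := by field_simp; ring
  have e2 : 1/(1+a') - 1/(1+(a'+b')) = b' / ((1+a')*(1+(a'+b'))) := by field_simp; ring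
  rw [e1, e2, ← mul_div_assoc, div_le_div_iff₀ (by positivity) (by positivity)]
  have i1 : 1 + a' ≤ E * (1+a) := by nlinarith
  have i2 : 1 + (a'+b') ≤ E * (1+(a+b)) := by nlinarith
  have i3 : (1+a')*(1+(a'+b')) ≤ (E * (1+a)) * (E * (1+(a+b))) :=
    mul_le_mul i1 i2 (by positivity) (by positivity)
  calc b * ((1+a')*(1+(a'+b'))) ≤ (E * b') * ((E * (1+a)) * (E * (1+(a+b)))) :=
        mul_le_mul h2 i3 (by positivity) (by positivity)
    _ = _ := by ring

lemma Gz_ratio (hk : 1 ≤ k) (p : Par d k K) (he : 0 ≤ p.e1) (hq : ∀ i, MonotoneHistQuery (p.q i))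
    (x y : Fin T → Fin d → Bool) (t₀ : Fin T) (hxy : ∀ r, r ≠ t₀ → x r = y r) (σ : Sta d) (t : ℕ)
    (hst : σ.2.1 ≤ t) :
    Gz p x σ t - Gz p x σ (t+1) ≤ Real.exp p.e1 ^ 3 * (Gz p y σ t - Gz p y σ (t+1)) := by
  have hyx : ∀ r, r ≠ t₀ → y r = x r := fun r hr => (hxy r hr).symm
  unfold Gz
  have e : ∀ x : Fin T → Fin d → Bool, Hz p x σ (t+1) = Hz p x σ t + hz p x σ t := fun x => by
    unfold Hz; rw [Finset.sum_Ico_succ_top hst]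
  rw [e x, e y]
  exact ratio_aux _ _ _ _ _ (Real.one_le_exp he) (Hz_nonneg _ _ _ _) (hz_pos _ _ _ _).le (Hz_nonneg _ _ _ _)
    (hz_pos _ _ _ _).le (Hz_near hk p he hq y x t₀ hyx σ t) (hz_near hk p he hq x y t₀ hxy σ t)
    (hz_near hk p he hq y x t₀ hyx σ t)

lemma Gz_ratio' (hk : 1 ≤ k) (p : Par d k K) (he : 0 ≤ p.e1) (hq : ∀ i, MonotoneHistQuery (p.q i))
    (x y : Fin T → Fin d → Bool) (t₀ : Fin T) (hxy : ∀ r, r ≠ t₀ → x r = y r) (σ : Sta d) (t : ℕ) :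
    Gz p x σ t ≤ Real.exp p.e1 ^ 3 * Gz p y σ t := by
  have hyx : ∀ r, r ≠ t₀ → y r = x r := fun r hr => (hxy r hr).symm
  have h1 := Hz_near hk p he hq y x t₀ hyx σ t
  have h2 := Hz_nonneg p x σ t
  have h3 := Hz_nonneg p y σ t
  have hE := Real.one_le_exp he
  unfold Gz
  rw [mul_one_div, div_le_div_iff₀ (by linarith) (by linarith)]
  have h4 : Real.exp p.e1 ≤ Real.exp p.e1 ^ 3 := le_self_pow₀ hE (by norm_num)
  calc 1 * (1 + Hz p y σ t) ≤ Real.exp p.e1 * (1 + Hz p x σ t) := by nlinarith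
    _ ≤ _ := by gcongr

section traj
variable (p : Par d k K) (x y : Fin T → Fin d → Bool) (U U' : Fin (T+1) → ℝ) (ω ω' : Fin d × K → ℝ)

lemma st_succ_cases (t : ℕ) :
    (Gz p x (st p x U ω t) (t+1) ≤ U (Fin.ofNat (T+1) (st p x U ω t).1) ∧ st p x U ω (t+1) =
      ((st p x U ω t).1 + 1, t + 1, fun c => ⌊(cnt x 0 (t+1) c : ℝ) + p.sg * Nz p ((st p x U ω t).1+1) ω c⌋₊)) ∨
    (U (Fin.ofNat (T+1) (st p x U ω t).1) < Gz p x (st p x U ω t) (t+1) ∧ st p x U ω (t+1) = st p x U ω t) := by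
  by_cases h : Gz p x (st p x U ω t) (t+1) ≤ U (Fin.ofNat (T+1) (st p x U ω t).1)
  · left; refine ⟨h, ?_⟩
    show stp p x U ω t (st p x U ω t) = _
    unfold stp; rw [if_pos h]
  · right; refine ⟨not_le.1 h, ?_⟩
    show stp p x U ω t (st p x U ω t) = _
    unfold stp; rw [if_neg h]

lemma st_le (t : ℕ) : (st p x U ω t).1 ≤ t ∧ (st p x U ω t).2.1 ≤ t := by
  induction t with
  | zero => simp [st]
  | succ t ih =>
    rcases st_succ_cases p x U ω t with ⟨_, h⟩ | ⟨_, h⟩ <;> rw [h] <;> constructor <;> (try dsimp only) <;> omega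

lemma st_mono {t t' : ℕ} (h : t ≤ t') : (st p x U ω t).1 ≤ (st p x U ω t').1 := by
  induction t', h using Nat.le_induction with
  | base => exact le_rfl
  | succ t' _ ih =>
    refine ih.trans ?_
    rcases st_succ_cases p x U ω t' with ⟨_, h⟩ | ⟨_, h⟩ <;> rw [h] <;> simp

lemma st_const {t t' : ℕ} (h : t ≤ t') (he : (st p x U ω t').1 = (st p x U ω t).1) :
    st p x U ω t' = st p x U ω t := by
  induction t', h using Nat.le_induction with
  | base => rfl
  | succ t' h1 ih =>
    have hm := st_mono p x U ω h1
    rcases st_succ_cases p x U ω t' with ⟨_, h⟩ | ⟨_, h⟩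
    · rw [h] at he; simp at he; omega
    · rw [h] at he ⊢; exact ih he

lemma st_nofire (t : ℕ) (h : (st p x U ω t).2.1 < t) :
    U (Fin.ofNat (T+1) (st p x U ω t).1) < Gz p x (st p x U ω t) t := by
  cases t with
  | zero => omega
  | succ t =>
    rcases st_succ_cases p x U ω t with ⟨_, h'⟩ | ⟨h1, h'⟩
    · rw [h'] at h; simp at h
    · rw [h']; exact h1

lemma st_congr (t : ℕ) (h : ∀ r : Fin T, r.val < t → x r = y r) : st p x U ω t = st p y U ω t := by
  induction t with
  | zero => rfl
  | succ t ih =>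
    have ih := ih fun r hr => h r (by omega)
    show stp p x U ω t (st p x U ω t) = stp p y U ω t (st p y U ω t)
    rw [ih]; unfold stp
    rw [Gz_congr p x y _ (t+1) (fun r _ => h r), cnt_congr x y 0 (t+1) (fun r _ => h r)]

lemma ofNat_ne {j n : ℕ} (hj : j ≤ T) (hn : n ≤ T) (h : j ≠ n) : Fin.ofNat (T+1) j ≠ Fin.ofNat (T+1) n := by
  intro he
  apply h
  have := congrArg Fin.val he
  simp only [Fin.val_ofNat] at this
  rwa [Nat.mod_eq_of_lt (by omega), Nat.mod_eq_of_lt (by omega)] at this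

lemma phase1 (t₀ : ℕ) (ht₀ : t₀ ≤ T) (hxy : ∀ r : Fin T, r.val < t₀ → x r = y r) (σ : Sta d)
    (hσ : st p x U ω t₀ = σ)
    (hU : ∀ i, i ≠ Fin.ofNat (T+1) σ.1 → U i = U' i)
    (hN : ∀ j c, j ≤ σ.1 → Nz p j ω' c = Nz p j ω c)
    (hn : ∀ t, t < t₀ → σ.2.1 ≤ t → U' (Fin.ofNat (T+1) σ.1) < Gz p y σ (t+1))
    (t : ℕ) (ht : t ≤ t₀) : st p x U ω t = st p y U' ω' t := by
  induction t with
  | zero => rfl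
  | succ t ih =>
    have ih := ih (by omega)
    have hG : Gz p x (st p x U ω t) (t+1) = Gz p y (st p x U ω t) (t+1) :=
      Gz_congr p x y _ (t+1) (fun r _ hr => hxy r (by omega))
    have hc := cnt_congr x y 0 (t+1) (fun r _ hr => hxy r (by omega))
    have hle : (st p x U ω t).1 ≤ σ.1 := by
      rw [← hσ]; exact st_mono p x U ω (by omega)
    have hnT : σ.1 ≤ T := by rw [← hσ]; exact (st_le p x U ω t₀).1.trans ht₀
    rcases eq_or_lt_of_le hle with he | hlt
    · have hs : st p x U ω t = σ := by
        rw [← hσ]; exact (st_const p x U ω (by omega) (by rw [hσ, he])).symm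
      have hs1 : st p x U ω (t+1) = σ := by
        rw [← hσ]
        refine (st_const p x U ω (by omega) ?_).symm
        apply le_antisymm _ (st_mono p x U ω (by omega))
        rw [hσ, ← hs]; exact st_mono p x U ω (by omega)
      have hst : σ.2.1 ≤ t := by rw [← hs]; exact (st_le p x U ω t).2
      have := hn t (by omega) hst
      rw [hs1]
      show σ = stp p y U' ω' t (st p y U' ω' t)
      rw [← ih, hs]; unfold stp; rw [if_neg (not_le.2 this)]
    · show stp p x U ω t (st p x U ω t) = stp p y U' ω' t (st p y U' ω' t)
      rw [← ih]
      unfold stp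
      rw [hG, hc, hU _ (ofNat_ne (by omega) hnT (by omega))]
      split_ifs with hf
      · simp only [hN _ _ (show (st p x U ω t).1 + 1 ≤ σ.1 by omega)]
      · rfl

lemma couple (t₀ : Fin T) (hxy : ∀ r : Fin T, r ≠ t₀ → x r = y r) (σ : Sta d)
    (hσ : st p x U ω t₀ = σ)
    (hU : ∀ i, i ≠ Fin.ofNat (T+1) σ.1 → U i = U' i)
    (hN : ∀ j c, j ≤ σ.1 → Nz p j ω' c = Nz p j ω c)
    (hN2 : ∀ j c, σ.1 < j → j ≤ T → p.sg * Nz p j ω' c = p.sg * Nz p j ω c + vdiff x y t₀ c)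
    (τ : ℕ) (hτ0 : t₀.val ≤ τ)
    (h1 : U (Fin.ofNat (T+1) σ.1) < Gz p x σ τ) (h1' : U' (Fin.ofNat (T+1) σ.1) < Gz p y σ τ)
    (h2 : τ < T → Gz p x σ (τ+1) ≤ U (Fin.ofNat (T+1) σ.1))
    (h2' : τ < T → Gz p y σ (τ+1) ≤ U' (Fin.ofNat (T+1) σ.1))
    (t : ℕ) (ht : t ≤ T) : st p x U ω t = st p y U' ω' t := by
  have hnT : σ.1 ≤ t₀.val := by rw [← hσ]; exact (st_le p x U ω t₀).1
  have hsT : σ.2.1 ≤ t₀.val := by rw [← hσ]; exact (st_le p x U ω t₀).2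
  have ph1 := phase1 p x y U U' ω ω' t₀.val t₀.isLt.le (fun r hr => hxy r (fun h => by rw [h] at hr; omega))
    σ hσ hU hN (fun t ht hs => lt_of_lt_of_le h1' (Gz_anti p y σ (by omega)))
  have ph2 : ∀ t, t₀.val ≤ t → t ≤ τ → st p x U ω t = σ ∧ st p y U' ω' t = σ := by
    intro t htt
    induction t, htt using Nat.le_induction with
    | base => intro _; exact ⟨hσ, by rw [← ph1 t₀.val le_rfl]; exact hσ⟩
    | succ t h3 ih =>
      intro h4
      obtain ⟨ha, hb⟩ := ih (by omega)
      constructor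
      · show stp p x U ω t (st p x U ω t) = σ
        rw [ha]; unfold stp
        rw [if_neg (not_le.2 (lt_of_lt_of_le h1 (Gz_anti p x σ h4)))]
      · show stp p y U' ω' t (st p y U' ω' t) = σ
        rw [hb]; unfold stp
        rw [if_neg (not_le.2 (lt_of_lt_of_le h1' (Gz_anti p y σ h4)))]
  have hfl : ∀ j t c, σ.1 < j → j ≤ T → t₀.val < t →
      (cnt x 0 t c : ℝ) + p.sg * Nz p j ω c = (cnt y 0 t c : ℝ) + p.sg * Nz p j ω' c := by
    intro j t c hj hjT htt
    have h5 := cnt_diff x y t₀ hxy 0 t c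
    rw [if_pos ⟨Nat.zero_le _, htt⟩] at h5
    have h6 : (cnt x 0 t c : ℝ) - cnt y 0 t c = vdiff x y t₀ c := by exact_mod_cast h5
    rw [hN2 j c hj hjT]; linarith
  have ph3 : ∀ t, τ + 1 ≤ t → t ≤ T → st p x U ω t = st p y U' ω' t ∧ σ.1 < (st p x U ω t).1 ∧
      t₀.val < (st p x U ω t).2.1 := by
    intro t htt
    induction t, htt using Nat.le_induction with
    | base =>
      intro hT
      obtain ⟨ha, hb⟩ := ph2 τ hτ0 le_rfl
      have e1 : st p x U ω (τ+1) = (σ.1 + 1, τ + 1, fun c => ⌊(cnt x 0 (τ+1) c : ℝ) + p.sg * Nz p (σ.1+1) ω c⌋₊) := by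
        show stp p x U ω τ (st p x U ω τ) = _
        rw [ha]; unfold stp; rw [if_pos (h2 (by omega))]
      have e2 : st p y U' ω' (τ+1) = (σ.1 + 1, τ + 1, fun c => ⌊(cnt y 0 (τ+1) c : ℝ) + p.sg * Nz p (σ.1+1) ω' c⌋₊) := by
        show stp p y U' ω' τ (st p y U' ω' τ) = _
        rw [hb]; unfold stp; rw [if_pos (h2' (by omega))]
      rw [e1, e2]
      refine ⟨?_, by simp, by simp; omega⟩
      congr 2
      funext c
      rw [hfl (σ.1+1) (τ+1) c (by omega) (by omega) (by omega)]
    | succ t h3 ih =>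
      intro h4
      obtain ⟨ha, hb, hc⟩ := ih (by omega)
      have hjt := (st_le p x U ω t).1
      constructor
      · show stp p x U ω t (st p x U ω t) = stp p y U' ω' t (st p y U' ω' t)
        rw [← ha]; unfold stp
        rw [Gz_congr p x y _ (t+1) (fun r hr _ => hxy r (fun h => by rw [h] at hr; omega)),
          hU _ (ofNat_ne (by omega) (by omega) (by omega))]
        split_ifs
        · congr 2
          funext c
          rw [hfl _ (t+1) c (by omega) (by omega) (by omega)]
        · rfl
      · rcases st_succ_cases p x U ω t with ⟨_, h⟩ | ⟨_, h⟩ <;> rw [h]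
        · simp; omega
        · exact ⟨hb, hc⟩
  rcases le_or_gt t t₀.val with h | h
  · exact ph1 t h
  · rcases le_or_gt t τ with h' | h'
    · obtain ⟨ha, hb⟩ := ph2 t h.le h'
      rw [ha, hb]
    · exact (ph3 t h' ht).1
end traj
end mech

open MeasureTheory

noncomputable def Pu : Measure ℝ := volume.restrict (Set.Ico (0:ℝ) 1)

instance : IsProbabilityMeasure Pu := by
  constructor; simp [Pu]

noncomputable def Pim (T : ℕ) : Measure (Fin (T+1) → ℝ) := Measure.pi fun _ => Pu

instance (T : ℕ) : IsProbabilityMeasure (Pim T) := by unfold Pim; infer_instance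

lemma Pim_update (T : ℕ) (n : Fin (T+1)) :
    ((Pim T).prod Pu).map (fun z : (Fin (T+1) → ℝ) × ℝ => Function.update z.1 n z.2) = Pim T := by
  have hm : Measurable (fun z : (Fin (T+1) → ℝ) × ℝ => Function.update z.1 n z.2) := by
    rw [measurable_pi_iff]
    intro a
    by_cases h : a = n
    · subst h; simp only [Function.update_self]; exact measurable_snd
    · simp only [Function.update_of_ne h]; fun_prop
  symm
  unfold Pim
  refine Measure.pi_eq fun s hs => ?_
  rw [Measure.map_apply hm (MeasurableSet.univ_pi hs)]
  have : (fun z : (Fin (T+1) → ℝ) × ℝ => Function.update z.1 n z.2) ⁻¹' (Set.univ.pi s)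
      = (Set.univ.pi (Function.update s n Set.univ)) ×ˢ (s n) := by
    ext z
    simp only [Set.mem_preimage, Set.mem_pi, Set.mem_univ, true_implies, Set.mem_prod]
    constructor
    · intro h
      refine ⟨fun i => ?_, by simpa using h n⟩
      by_cases hi : i = n
      · subst hi; simp
      · simpa [Function.update_of_ne hi] using h i
    · rintro ⟨h1, h2⟩ i
      by_cases hi : i = n
      · subst hi; simpa using h2
      · simpa [Function.update_of_ne hi] using h1 i
  rw [this, Measure.prod_prod, Measure.pi_pi, ← Finset.mul_prod_erase _ _ (Finset.mem_univ n),
    ← Finset.mul_prod_erase (Finset.univ) (fun i => Pu (s i)) (Finset.mem_univ n)]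
  rw [Function.update_self, measure_univ, one_mul, mul_comm]
  congr 1
  refine Finset.prod_congr rfl fun i hi => ?_
  rw [Function.update_of_ne (Finset.ne_of_mem_erase hi)]

section mech
set_option linter.all false
variable {d k T : ℕ} {K : Type} [Fintype K]

noncomputable def Mu (T d : ℕ) (K : Type) [Fintype K] : Measure ((Fin (T+1) → ℝ) × (Fin d × K → ℝ)) :=
  (Pim T).prod (gm (Fin d × K))

instance : IsProbabilityMeasure (Mu T d K) := by unfold Mu; infer_instance

noncomputable def outp (p : Par d k K) (x : Fin T → Fin d → Bool)
    (z : (Fin (T+1) → ℝ) × (Fin d × K → ℝ)) : Fin T → Fin k → ℝ :=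
  fun t i => p.q i (st p x z.1 z.2 (t.val+1)).2.2

lemma st_meas (p : Par d k K) (x : Fin T → Fin d → Bool) (t : ℕ) :
    Measurable fun z : (Fin (T+1) → ℝ) × (Fin d × K → ℝ) => st p x z.1 z.2 t := by
  induction t with
  | zero => exact measurable_const
  | succ t ih =>
    have h0 : ∀ σ : Sta d, Measurable fun z : (Fin (T+1) → ℝ) × (Fin d × K → ℝ) => stp p x z.1 z.2 t σ := by
      intro σ
      unfold stp
      refine Measurable.ite ?_ ?_ measurable_const
      · exact measurableSet_le measurable_const ((measurable_pi_apply _).comp measurable_fst)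
      · refine Measurable.prodMk measurable_const (Measurable.prodMk measurable_const ?_)
        rw [measurable_pi_iff]
        intro c
        refine Nat.measurable_floor.comp ?_
        unfold Nz
        fun_prop
    have h : Measurable fun w : (Sta d) × ((Fin (T+1) → ℝ) × (Fin d × K → ℝ)) => stp p x w.2.1 w.2.2 t w.1 :=
      measurable_from_prod_countable_right h0
    have h2 := h.comp (ih.prodMk measurable_id)
    have h3 : (fun z : (Fin (T+1) → ℝ) × (Fin d × K → ℝ) => st p x z.1 z.2 (t+1)) =
      ((fun w : (Sta d) × ((Fin (T+1) → ℝ) × (Fin d × K → ℝ)) => stp p x w.2.1 w.2.2 t w.1) ∘ fun z => (st p x z.1 z.2 t, id z)) := by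
      funext z
      simp only [Function.comp, id, st]
    rw [h3]; exact h2

lemma outp_meas (p : Par d k K) (x : Fin T → Fin d → Bool) : Measurable (outp p x) := by
  rw [measurable_pi_iff]; intro t
  rw [measurable_pi_iff]; intro i
  exact (measurable_of_countable (fun σ : Sta d => p.q i σ.2.2)).comp (st_meas p x (t.val+1))

noncomputable def Mech (p : Par d k K) (x : Fin T → Fin d → Bool) : Measure (Fin T → Fin k → ℝ) :=
  (Mu T d K).map (outp p x)

lemma Mech_CO (p : Par d k K) : IsCOMech (Mech (T := T) p) := by
  refine ⟨measurable_of_countable _, fun x => ?_, ?_⟩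
  · exact Measure.isProbabilityMeasure_map (outp_meas p x).aemeasurable
  · intro t x y h
    unfold Mech
    rw [Measure.map_map (by fun_prop) (outp_meas p x), Measure.map_map (by fun_prop) (outp_meas p y)]
    congr 1
    funext z s i
    simp only [Function.comp, outp]
    rw [st_congr p x y z.1 z.2 (s.1.val+1) (fun r hr => h r (by
      have h1 := s.2
      rw [Fin.le_def] at h1 ⊢; omega))]

noncomputable def lo (p : Par d k K) (x : Fin T → Fin d → Bool) (σ : Sta d) (τ : ℕ) : ℝ :=
  if τ < T then Gz p x σ (τ+1) else 0

lemma lo_nonneg (p : Par d k K) (x : Fin T → Fin d → Bool) (σ : Sta d) (τ : ℕ) : 0 ≤ lo p x σ τ := by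
  unfold lo; split_ifs
  · exact (Gz_pos _ _ _ _).le
  · exact le_rfl

lemma find_tau (p : Par d k K) (x : Fin T → Fin d → Bool) (σ : Sta d) (e : ℝ) (he : 0 ≤ e) (t₀ : ℕ) (ht : t₀ ≤ T)
    (h : e < Gz p x σ t₀) : ∃ τ ∈ Finset.Icc t₀ T, e ∈ Set.Ico (lo p x σ τ) (Gz p x σ τ) := by
  induction h' : T - t₀ generalizing t₀ with
  | zero =>
    refine ⟨t₀, by simp; omega, ?_, h⟩
    unfold lo; rw [if_neg (by omega)]; exact he
  | succ m ih =>
    by_cases hc : e < Gz p x σ (t₀+1)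
    · obtain ⟨τ, h1, h2⟩ := ih (t₀+1) (by omega) hc (by omega)
      refine ⟨τ, ?_, h2⟩
      simp at h1 ⊢; omega
    · refine ⟨t₀, by simp; omega, ?_, h⟩
      unfold lo; rw [if_pos (by omega)]; exact not_lt.1 hc

lemma sec_le (hk : 1 ≤ k) (p : Par d k K) (he : 0 ≤ p.e1) (hq : ∀ i, MonotoneHistQuery (p.q i))
    (x y : Fin T → Fin d → Bool) (t₀ : Fin T) (hxy : ∀ r, r ≠ t₀ → x r = y r) (σ : Sta d)
    (U : Fin (T+1) → ℝ) (ω ω' : Fin d × K → ℝ)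
    (hN : ∀ j c, j ≤ σ.1 → j ≤ T → Nz p j ω' c = Nz p j ω c)
    (hN2 : ∀ j c, σ.1 < j → j ≤ T → p.sg * Nz p j ω' c = p.sg * Nz p j ω c + vdiff x y t₀ c)
    (S : Set (Fin T → Fin k → ℝ)) :
    Pu {e | st p x (Function.update U (Fin.ofNat (T+1) σ.1) e) ω t₀ = σ ∧
        outp p x (Function.update U (Fin.ofNat (T+1) σ.1) e, ω) ∈ S} ≤
      ENNReal.ofReal (Real.exp p.e1 ^ 3) *
    Pu {e | st p y (Function.update U (Fin.ofNat (T+1) σ.1) e) ω' t₀ = σ ∧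
        outp p y (Function.update U (Fin.ofNat (T+1) σ.1) e, ω') ∈ S} := by
  classical
  set n := Fin.ofNat (T+1) σ.1 with hn
  set X := {e | st p x (Function.update U n e) ω t₀ = σ ∧ outp p x (Function.update U n e, ω) ∈ S} with hX
  set Y := {e | st p y (Function.update U n e) ω' t₀ = σ ∧ outp p y (Function.update U n e, ω') ∈ S} with hY
  set Θ := (Finset.Icc t₀.val T).filter (fun τ => ∃ e ∈ X, e ∈ Set.Ico (lo p x σ τ) (Gz p x σ τ)) with hΘ
  have hsub : X ∩ Set.Ico 0 1 ⊆ ⋃ τ ∈ Θ, Set.Ico (lo p x σ τ) (Gz p x σ τ) := by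
    rintro e ⟨heX, he01⟩
    have hlt : e < Gz p x σ t₀ := by
      have hs := (st_le p x (Function.update U n e) ω t₀).2
      rw [heX.1] at hs
      rcases eq_or_lt_of_le hs with h | h
      · rw [← h, Gz_self]; exact he01.2
      · have := st_nofire p x (Function.update U n e) ω t₀ (by rw [heX.1]; exact h)
        rw [heX.1, ← hn, Function.update_self] at this
        exact this
    obtain ⟨τ, h1, h2⟩ := find_tau p x σ e he01.1 t₀ t₀.isLt.le hlt
    simp only [Set.mem_iUnion]
    exact ⟨τ, Finset.mem_filter.2 ⟨h1, e, heX, h2⟩, h2⟩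
  have hsub2 : (⋃ τ ∈ Θ, Set.Ico (lo p y σ τ) (Gz p y σ τ)) ⊆ Y ∩ Set.Ico 0 1 := by
    intro e' he'
    simp only [Set.mem_iUnion] at he'
    obtain ⟨τ, hτ, he'⟩ := he'
    obtain ⟨hτ1, e, heX, heI⟩ := Finset.mem_filter.1 hτ
    rw [Finset.mem_Icc] at hτ1
    refine ⟨?_, (lo_nonneg _ _ _ _).trans he'.1, lt_of_lt_of_le he'.2 (Gz_le_one _ _ _ _)⟩
    have hσT : σ.1 ≤ T := by
      rw [← heX.1]; exact (st_le p x _ ω t₀).1.trans t₀.isLt.le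
    have hc := couple p x y (Function.update U n e) (Function.update U n e') ω ω' t₀ hxy σ heX.1
      (fun i hi => by rw [Function.update_of_ne hi, Function.update_of_ne hi]) (fun j c hj => hN j c hj (hj.trans hσT)) hN2 τ hτ1.1
      (by rw [← hn, Function.update_self]; exact heI.2)
      (by rw [← hn, Function.update_self]; exact he'.2)
      (fun h => by rw [← hn, Function.update_self]; have := heI.1; unfold lo at this; rwa [if_pos h] at this)
      (fun h => by rw [← hn, Function.update_self]; have := he'.1; unfold lo at this; rwa [if_pos h] at this)
    refine ⟨?_, ?_⟩
    · rw [← hc t₀ t₀.isLt.le]; exact heX.1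
    · have : outp p y (Function.update U n e', ω') = outp p x (Function.update U n e, ω) := by
        funext t i
        simp only [outp]
        rw [hc (t.val+1) t.isLt]
      rw [this]; exact heX.2
  have hσs : ∀ τ ∈ Θ, σ.2.1 ≤ τ := by
    intro τ hτ
    obtain ⟨hτ1, e, heX, heI⟩ := Finset.mem_filter.1 hτ
    rw [Finset.mem_Icc] at hτ1
    have := (st_le p x (Function.update U n e) ω t₀).2
    rw [heX.1] at this
    omega
  have hdis : Set.PairwiseDisjoint (Θ : Set ℕ) (fun τ => Set.Ico (lo p y σ τ) (Gz p y σ τ)) := by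
    have key : ∀ a b, a ∈ Θ → b ∈ Θ → a < b → Disjoint (Set.Ico (lo p y σ a) (Gz p y σ a)) (Set.Ico (lo p y σ b) (Gz p y σ b)) := by
      intro a b ha hb hab
      rw [Set.disjoint_left]
      rintro e h1 h2
      have hbT := (Finset.mem_Icc.1 (Finset.mem_filter.1 hb).1).2
      have h3 := h1.1
      unfold lo at h3
      rw [if_pos (by omega)] at h3
      have := Gz_anti p y σ (show a+1 ≤ b from hab)
      have := h2.2
      linarith
    intro a ha b hb hab
    rcases lt_or_gt_of_ne hab with h | h
    · exact key a b ha hb h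
    · exact (key b a hb ha h).symm
  unfold Pu
  rw [Measure.restrict_apply' measurableSet_Ico, Measure.restrict_apply' measurableSet_Ico]
  calc volume (X ∩ Set.Ico 0 1) ≤ volume (⋃ τ ∈ Θ, Set.Ico (lo p x σ τ) (Gz p x σ τ)) := measure_mono hsub
    _ ≤ ∑ τ ∈ Θ, volume (Set.Ico (lo p x σ τ) (Gz p x σ τ)) := measure_biUnion_finset_le _ _
    _ ≤ ∑ τ ∈ Θ, ENNReal.ofReal (Real.exp p.e1 ^ 3) * volume (Set.Ico (lo p y σ τ) (Gz p y σ τ)) := by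
        refine Finset.sum_le_sum fun τ hτ => ?_
        rw [Real.volume_Ico, Real.volume_Ico, ← ENNReal.ofReal_mul (by positivity)]
        apply ENNReal.ofReal_le_ofReal
        unfold lo
        split_ifs
        · exact Gz_ratio hk p he hq x y t₀ hxy σ τ (hσs τ hτ)
        · rw [sub_zero, sub_zero]; exact Gz_ratio' hk p he hq x y t₀ hxy σ τ
    _ = ENNReal.ofReal (Real.exp p.e1 ^ 3) * volume (⋃ τ ∈ Θ, Set.Ico (lo p y σ τ) (Gz p y σ τ)) := by
        rw [measure_biUnion_finset hdis (fun _ _ => measurableSet_Ico), Finset.mul_sum]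
    _ ≤ _ := by gcongr

lemma Mu_update (n : Fin (T+1)) (B : Set ((Fin (T+1) → ℝ) × (Fin d × K → ℝ))) (hB : MeasurableSet B) :
    Mu T d K B = ∫⁻ ω, ∫⁻ U, Pu {e | (Function.update U n e, ω) ∈ B} ∂(Pim T) ∂(gm (Fin d × K)) := by
  have hm : Measurable (fun z : (Fin (T+1) → ℝ) × ℝ => Function.update z.1 n z.2) := by
    rw [measurable_pi_iff]
    intro a
    by_cases h : a = n
    · subst h; simp only [Function.update_self]; exact measurable_snd
    · simp only [Function.update_of_ne h]; fun_prop
  unfold Mu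
  rw [Measure.prod_apply_symm hB]
  refine lintegral_congr fun ω => ?_
  have hBω : MeasurableSet ((fun U => (U, ω)) ⁻¹' B) := measurable_prodMk_right hB
  conv_lhs => rw [← Pim_update T n]
  rw [Measure.map_apply hm hBω, Measure.prod_apply (hm hBω)]
  rfl

noncomputable def shw (p : Par d k K) (W : ℕ → K → ℝ) (v : Fin d → ℤ) (n : ℕ) : Fin d × K → ℝ :=
  fun z => (v z.1 : ℝ) * W n z.2 / p.sg

lemma Nz_add (p : Par d k K) (j : ℕ) (ω w : Fin d × K → ℝ) (c : Fin d) (r : ℝ) :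
    Nz p j (ω + r • w) c = Nz p j ω c + r * Nz p j w c := by
  unfold Nz
  rw [Finset.mul_sum, ← Finset.sum_add_distrib]
  refine Finset.sum_congr rfl fun κ _ => ?_
  simp only [Pi.add_apply, Pi.smul_apply, smul_eq_mul]; ring

lemma Nz_shw (p : Par d k K) (W : ℕ → K → ℝ) (v : Fin d → ℤ) (n j : ℕ) (c : Fin d)
    (hDW : ∑ κ, p.D j κ * W n κ = if n < j then 1 else 0) :
    Nz p j (shw p W v n) c = if n < j then (v c : ℝ) / p.sg else 0 := by
  unfold Nz shw
  have : ∀ κ, p.D j κ * ((v c : ℝ) * W n κ / p.sg) = (v c : ℝ) / p.sg * (p.D j κ * W n κ) := by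
    intro κ; ring
  simp only [this]
  rw [← Finset.mul_sum, hDW]; split_ifs <;> simp

lemma dotp_shw (p : Par d k K) (W : ℕ → K → ℝ) (v : Fin d → ℤ) (hv : ∀ c, (v c).natAbs ≤ 1) (n : ℕ)
    (hW : ∑ κ, W n κ ^ 2 ≤ 3) : dotp (shw p W v n) (shw p W v n) ≤ 3 * d / p.sg^2 := by
  unfold dotp shw
  rw [Fintype.sum_prod_type]
  have : ∀ c : Fin d, ∑ κ, (v c : ℝ) * W n κ / p.sg * ((v c : ℝ) * W n κ / p.sg) ≤ 3 / p.sg^2 := by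
    intro c
    have e : ∀ κ, (v c : ℝ) * W n κ / p.sg * ((v c : ℝ) * W n κ / p.sg) = (v c : ℝ)^2 / p.sg^2 * W n κ ^ 2 := by
      intro κ; ring
    simp only [e]
    rw [← Finset.mul_sum]
    have hv2 : (v c : ℝ)^2 ≤ 1 := by
      have h := hv c
      have h2 : |v c| ≤ 1 := abs_le.2 ⟨by omega, by omega⟩
      have h3 : (v c)^2 ≤ 1 := by rw [← sq_abs]; nlinarith [abs_nonneg (v c)]
      exact_mod_cast h3
    calc (v c : ℝ)^2 / p.sg^2 * ∑ κ, W n κ ^ 2 ≤ 1 / p.sg^2 * 3 := by gcongr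
      _ = _ := by ring
  calc _ ≤ ∑ c : Fin d, 3 / p.sg^2 := Finset.sum_le_sum fun c _ => this c
    _ = _ := by rw [Finset.sum_const, Finset.card_univ, Fintype.card_fin, nsmul_eq_mul]; ring

lemma priv_sigma (hk : 1 ≤ k) (p : Par d k K) (he : 0 ≤ p.e1) (hq : ∀ i, MonotoneHistQuery (p.q i))
    (hsg : 0 < p.sg) (W : ℕ → K → ℝ)
    (hDW : ∀ n j, n ≤ T → j ≤ T → ∑ κ, p.D j κ * W n κ = if n < j then 1 else 0)
    (hW : ∀ n, n ≤ T → ∑ κ, W n κ ^ 2 ≤ 3) (e2 s δ' : ℝ) (hs : 0 ≤ s)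
    (hδ : Real.exp (-s*e2 + s*(1+s)*(3*d/p.sg^2)/2) ≤ δ')
    (x y : Fin T → Fin d → Bool) (t₀ : Fin T) (hxy : ∀ r, r ≠ t₀ → x r = y r) (σ : Sta d)
    (S : Set (Fin T → Fin k → ℝ)) (hS : MeasurableSet S) :
    Mu T d K {z | st p x z.1 z.2 t₀ = σ ∧ outp p x z ∈ S} ≤
      ENNReal.ofReal (Real.exp p.e1 ^ 3) * (ENNReal.ofReal (Real.exp e2) *
        Mu T d K {z | st p y z.1 z.2 t₀ = σ ∧ outp p y z ∈ S} + ENNReal.ofReal δ' *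
        Mu T d K {z | st p y z.1 z.2 t₀ = σ}) := by
  have mA : ∀ x : Fin T → Fin d → Bool, MeasurableSet {z : (Fin (T+1) → ℝ) × (Fin d × K → ℝ) | st p x z.1 z.2 t₀ = σ} :=
    fun x => st_meas p x t₀ (measurableSet_singleton σ)
  have mB : ∀ x : Fin T → Fin d → Bool, MeasurableSet {z : (Fin (T+1) → ℝ) × (Fin d × K → ℝ) | st p x z.1 z.2 t₀ = σ ∧ outp p x z ∈ S} :=
    fun x => (mA x).inter (outp_meas p x hS)
  by_cases hσT : σ.1 ≤ T
  swap
  · have : {z : (Fin (T+1) → ℝ) × (Fin d × K → ℝ) | st p x z.1 z.2 t₀ = σ ∧ outp p x z ∈ S} = ∅ := by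
      ext z; simp only [Set.mem_setOf_eq, Set.mem_empty_iff_false, iff_false]
      rintro ⟨h, _⟩
      apply hσT
      rw [← h]; exact (st_le p x z.1 z.2 t₀).1.trans t₀.isLt.le
    rw [this]; simp
  set w := shw p W (vdiff x y t₀) σ.1 with hw
  have hNw : ∀ j c, j ≤ T → Nz p j w c = if σ.1 < j then (vdiff x y t₀ c : ℝ) / p.sg else 0 := fun j c hj =>
    Nz_shw p W _ σ.1 j c (hDW σ.1 j hσT hj)
  have hadd : ∀ (ω : Fin d × K → ℝ) j c, Nz p j (ω + w) c = Nz p j ω c + Nz p j w c := by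
    intro ω j c
    have := Nz_add p j ω w c 1
    simpa using this
  have step1 : Mu T d K {z | st p x z.1 z.2 t₀ = σ ∧ outp p x z ∈ S} ≤
      ENNReal.ofReal (Real.exp p.e1 ^ 3) * Mu T d K {z | st p y z.1 (z.2 + w) t₀ = σ ∧ outp p y (z.1, z.2 + w) ∈ S} := by
    have mB' : MeasurableSet {z : (Fin (T+1) → ℝ) × (Fin d × K → ℝ) | st p y z.1 (z.2 + w) t₀ = σ ∧ outp p y (z.1, z.2 + w) ∈ S} := by
      have hf : Measurable fun z : (Fin (T+1) → ℝ) × (Fin d × K → ℝ) => (z.1, z.2 + w) := by fun_prop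
      exact hf (mB y)
    rw [Mu_update (Fin.ofNat (T+1) σ.1) _ (mB x), Mu_update (Fin.ofNat (T+1) σ.1) _ mB',
      ← lintegral_const_mul' _ _ ENNReal.ofReal_ne_top]
    refine lintegral_mono fun ω => ?_
    rw [← lintegral_const_mul' _ _ ENNReal.ofReal_ne_top]
    refine lintegral_mono fun U => ?_
    exact sec_le hk p he hq x y t₀ hxy σ U ω (ω + w)
      (fun j c hj hjT => by rw [hadd, hNw j c hjT, if_neg (by omega), add_zero])
      (fun j c hj hjT => by rw [hadd, hNw j c hjT, if_pos hj]; field_simp) S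
  refine step1.trans ?_
  gcongr
  have mB' : MeasurableSet {z : (Fin (T+1) → ℝ) × (Fin d × K → ℝ) | st p y z.1 (z.2 + w) t₀ = σ ∧ outp p y (z.1, z.2 + w) ∈ S} := by
    have hf : Measurable fun z : (Fin (T+1) → ℝ) × (Fin d × K → ℝ) => (z.1, z.2 + w) := by fun_prop
    exact hf (mB y)
  unfold Mu
  rw [Measure.prod_apply mB', Measure.prod_apply (mB y), Measure.prod_apply (mA y),
    ← lintegral_const_mul' _ _ ENNReal.ofReal_ne_top, ← lintegral_const_mul' _ _ ENNReal.ofReal_ne_top,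
    ← lintegral_add_left ((measurable_measure_prodMk_left (mB y)).const_mul _)]
  refine lintegral_mono fun U => ?_
  have mAU : MeasurableSet (Prod.mk U ⁻¹' {z : (Fin (T+1) → ℝ) × (Fin d × K → ℝ) | st p y z.1 z.2 t₀ = σ}) :=
    measurable_prodMk_left (mA y)
  have mBU : MeasurableSet (Prod.mk U ⁻¹' {z : (Fin (T+1) → ℝ) × (Fin d × K → ℝ) | st p y z.1 z.2 t₀ = σ ∧ outp p y z ∈ S}) :=
    measurable_prodMk_left (mB y)
  have key : ∀ (r : ℝ) (ω : Fin d × K → ℝ), st p y U ω t₀ = σ → st p y U (ω + r • w) t₀ = σ := by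
    intro r ω h
    rw [← h]; symm
    refine phase1 p y y U U ω (ω + r • w) t₀ t₀.isLt.le (fun _ _ => rfl) σ h (fun _ _ => rfl) ?_ ?_ t₀ le_rfl
    · intro j c hj
      rw [Nz_add, hNw j c (hj.trans hσT), if_neg (by omega)]; ring
    · intro t ht hst
      have h1 := st_nofire p y U ω t₀ (by rw [h]; omega)
      rw [h] at h1
      exact lt_of_lt_of_le h1 (Gz_anti p y σ ht)
  have hp := gm_priv w _ _ mAU mBU (fun ω hω => hω.1) e2 s hs (by
    intro r ω
    constructor
    · intro h
      have := key (-r) _ h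
      have e : ω + r • w + (-r) • w = ω := by
        rw [neg_smul, add_neg_cancel_right]
      rw [e] at this; exact this
    · exact key r ω)
  refine hp.trans ?_
  have hd := dotp_shw p W (vdiff x y t₀) (vdiff_abs x y t₀) σ.1 (hW σ.1 hσT)
  have : Real.exp (-s*e2 + s*(1+s)*dotp w w/2) ≤ δ' := by
    refine le_trans (Real.exp_le_exp.2 ?_) hδ
    gcongr
  gcongr

theorem Mech_priv (hk : 1 ≤ k) (p : Par d k K) (he : 0 ≤ p.e1) (hq : ∀ i, MonotoneHistQuery (p.q i))
    (hsg : 0 < p.sg) (W : ℕ → K → ℝ)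
    (hDW : ∀ n j, n ≤ T → j ≤ T → ∑ κ, p.D j κ * W n κ = if n < j then 1 else 0)
    (hW : ∀ n, n ≤ T → ∑ κ, W n κ ^ 2 ≤ 3) (e2 s δ' : ℝ) (hs : 0 ≤ s)
    (hδ : Real.exp (-s*e2 + s*(1+s)*(3*d/p.sg^2)/2) ≤ δ')
    (x y : Fin T → Fin d → Bool) (t₀ : Fin T) (hxy : ∀ r, r ≠ t₀ → x r = y r)
    (S : Set (Fin T → Fin k → ℝ)) (hS : MeasurableSet S) :
    Mech p x S ≤ ENNReal.ofReal (Real.exp p.e1 ^ 3) * (ENNReal.ofReal (Real.exp e2) * Mech p y S + ENNReal.ofReal δ') := by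
  have hdec : ∀ (x : Fin T → Fin d → Bool) (B : Set ((Fin (T+1) → ℝ) × (Fin d × K → ℝ))), MeasurableSet B →
      Mu T d K B = ∑' σ : Sta d, Mu T d K ({z | st p x z.1 z.2 t₀ = σ} ∩ B) := by
    intro x B hB
    rw [← measure_iUnion]
    · congr 1; ext z; simp
    · intro a b hab
      refine Set.disjoint_left.2 ?_
      rintro z ⟨h1, _⟩ ⟨h2, _⟩
      exact hab (h1.symm.trans h2)
    · exact fun σ => (st_meas p x t₀ (measurableSet_singleton σ)).inter hB
  unfold Mech
  rw [Measure.map_apply (outp_meas p x) hS, Measure.map_apply (outp_meas p y) hS,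
    hdec x _ (outp_meas p x hS), hdec y _ (outp_meas p y hS)]
  have h1 : (∑' σ : Sta d, Mu T d K ({z | st p y z.1 z.2 t₀ = σ})) = 1 := by
    have := hdec y Set.univ MeasurableSet.univ
    simp only [Set.inter_univ] at this
    rw [← this]; simp
  calc _ ≤ ∑' σ : Sta d, ENNReal.ofReal (Real.exp p.e1 ^ 3) * (ENNReal.ofReal (Real.exp e2) *
        Mu T d K {z | st p y z.1 z.2 t₀ = σ ∧ outp p y z ∈ S} + ENNReal.ofReal δ' *
        Mu T d K {z | st p y z.1 z.2 t₀ = σ}) :=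
        ENNReal.tsum_le_tsum fun σ => priv_sigma hk p he hq hsg W hDW hW e2 s δ' hs hδ x y t₀ hxy σ S hS
    _ = _ := by
        rw [ENNReal.tsum_mul_left, ENNReal.tsum_add, ENNReal.tsum_mul_left, ENNReal.tsum_mul_left, h1, mul_one]
        rfl
end mech

open MeasureTheory

lemma q_lip_nat {d : ℕ} (q : (Fin d → ℕ) → ℝ) (hq : MonotoneHistQuery q) (m : ℕ) :
    ∀ v w : Fin d → ℕ, (∀ c, ((v c : ℤ) - w c).natAbs ≤ m) → |q v - q w| ≤ m := by
  induction m with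
  | zero =>
    intro v w h
    have : v = w := by funext c; have := h c; omega
    subst this; simp
  | succ m ih =>
    intro v w h
    set u : Fin d → ℕ := fun c => if v c < w c then v c + 1 else if w c < v c then v c - 1 else v c with hu
    have h1 : |q v - q u| ≤ 1 := by
      apply hq.2.2.2
      intro c
      simp only [hu]; split_ifs <;> omega
    have h2 : |q u - q w| ≤ m := by
      apply ih
      intro c
      have := h c
      simp only [hu]; split_ifs <;> omega
    have := abs_sub_le (q v) (q u) (q w)
    push_cast; linarith

lemma q_lip {d : ℕ} (q : (Fin d → ℕ) → ℝ) (hq : MonotoneHistQuery q) (E : ℝ) (hE : 0 ≤ E)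
    (v w : Fin d → ℕ) (h : ∀ c, |(v c : ℝ) - w c| ≤ E) : |q v - q w| ≤ E := by
  refine (q_lip_nat q hq ⌊E⌋₊ v w fun c => ?_).trans (Nat.floor_le hE)
  apply Nat.le_floor
  refine le_trans (le_of_eq ?_) (h c)
  rw [Nat.cast_natAbs]; push_cast; rfl

lemma floor_near (n : ℕ) (y e : ℝ) (h : |y| ≤ e) : |(⌊(n:ℝ) + y⌋₊ : ℝ) - n| ≤ e + 1 := by
  have h2 := abs_le.1 h
  have hn : (0:ℝ) ≤ n := n.cast_nonneg
  by_cases h0 : 0 ≤ (n:ℝ) + y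
  · have h1 := Nat.floor_le h0
    have h3 := Nat.lt_floor_add_one ((n:ℝ) + y)
    rw [abs_le]; constructor <;> linarith
  · rw [Nat.floor_of_nonpos (by linarith)]
    rw [abs_le]; push_cast; constructor <;> linarith

section mech
set_option linter.all false
variable {d k T : ℕ} {K : Type} [Fintype K]

lemma Fq_mono (hk : 1 ≤ k) (p : Par d k K) (hq : ∀ i, MonotoneHistQuery (p.q i))
    (x : Fin T → Fin d → Bool) (s : ℕ) (g : Fin d → ℕ) {r r' : ℕ} (h : r ≤ r') :
    Fq p x s g r ≤ Fq p x s g r' := by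
  haveI : Nonempty (Fin k) := ⟨⟨0, hk⟩⟩
  refine ciSup_le fun i => le_trans ?_ (le_Fq p x s g r' i)
  have := (hq i).2.2.1 (fun c => g c + cnt x s r c) (fun c => g c + cnt x s r' c)
    (fun c => Nat.add_le_add_left (cnt_mono x s r r' h c) _)
  linarith

lemma path (hk : 1 ≤ k) (hT : 1 ≤ T) (p : Par d k K) (hq : ∀ i, MonotoneHistQuery (p.q i))
    (he1 : 0 < p.e1) (e : ℕ → ℝ) (he : ∀ j, 0 ≤ e j) (b B : ℝ) (hb : 0 < b) (hb1 : b < 1)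
    (hB : (T:ℝ) / b ≤ Real.exp (p.e1 * B)) (hDl : ∀ j, p.Dl j = 2 * (e j + 1) + B + 1)
    (x : Fin T → Fin d → Bool) (U : Fin (T+1) → ℝ) (ω : Fin d × K → ℝ)
    (hU : ∀ n, b ≤ U n ∧ U n ≤ 1 - b)
    (hω : ∀ j, 1 ≤ j → j ≤ T → ∀ c, |p.sg * Nz p j ω c| ≤ e j) (t : ℕ) (ht : t ≤ T) :
    ((∀ c, |((st p x U ω t).2.2 c : ℝ) - cnt x 0 (st p x U ω t).2.1 c| ≤ e (st p x U ω t).1 + 1) ∧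
      ((st p x U ω t).1 : ℝ) ≤ ∑ i, p.q i (cnt x 0 (st p x U ω t).2.1)) ∧
    (∀ i, |p.q i (st p x U ω t).2.2 - p.q i (cnt x 0 t)| ≤ 3 * (e (st p x U ω t).1 + 1) + 2 * B + 1) := by
  haveI : Nonempty (Fin k) := ⟨⟨0, hk⟩⟩
  have hT0 : (1:ℝ) ≤ T := by exact_mod_cast hT
  have hexpB : 0 < Real.exp (p.e1 * B) := Real.exp_pos _
  have hB1 : 1 / b ≤ Real.exp (p.e1 * B) := le_trans (by gcongr) hB
  have hB0 : 0 ≤ B := by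
    by_contra hn
    push Not at hn
    have h1 : Real.exp (p.e1 * B) < 1 := by
      rw [Real.exp_lt_one_iff]; nlinarith
    have h2 : 1 < 1 / b := by rw [lt_div_iff₀ hb]; linarith
    linarith
  induction t with
  | zero =>
    have e0 := he 0
    have hc : cnt x 0 0 = fun _ => 0 := by funext c; exact cnt_self x 0 c
    refine ⟨⟨fun c => ?_, ?_⟩, fun i => ?_⟩
    · simp only [st, hc]; simp; linarith
    · simp only [st]; push_cast
      exact Finset.sum_nonneg fun i _ => (hq i).1 _
    · simp only [st, hc]; simp; linarith
  | succ t ih =>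
    obtain ⟨⟨ih1, ih2⟩, -⟩ := ih (by omega)
    have hle := st_le p x U ω t
    have hs := st_succ_cases p x U ω t
    set σ := st p x U ω t with hσ
    have ej := he σ.1
    -- near
    have near1 : ∀ i, |p.q i σ.2.2 - p.q i (cnt x 0 σ.2.1)| ≤ e σ.1 + 1 := fun i =>
      q_lip _ (hq i) _ (by linarith) _ _ ih1
    have near2 : ∀ i, |p.q i (fun c => σ.2.2 c + cnt x σ.2.1 (t+1) c) - p.q i (cnt x 0 (t+1))| ≤ e σ.1 + 1 := fun i => by
      refine q_lip _ (hq i) _ (by linarith) _ _ fun c => ?_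
      rw [← cnt_add x σ.2.1 (t+1) (by omega) c]
      have := ih1 c
      push_cast
      convert this using 2; ring
    have hHt : Hz p x σ (t+1) ≤ T * hz p x σ t := by
      unfold Hz
      calc _ ≤ ∑ r ∈ Finset.Ico σ.2.1 (t+1), hz p x σ t := by
            refine Finset.sum_le_sum fun r hr => ?_
            have hr := Finset.mem_Ico.1 hr
            unfold hz
            have := Fq_mono hk p hq x σ.2.1 σ.2.2 (r := r+1) (r' := t+1) (by omega)
            gcongr
        _ = ((t + 1 - σ.2.1 : ℕ) : ℝ) * hz p x σ t := by
            rw [Finset.sum_const, Nat.card_Ico, nsmul_eq_mul]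
        _ ≤ _ := by
            have := hz_pos p x σ t
            gcongr; omega
    have hH0 := Hz_nonneg p x σ (t+1)
    have hHt2 : hz p x σ t ≤ Hz p x σ (t+1) := by
      unfold Hz
      exact Finset.single_le_sum (f := fun r => hz p x σ r) (fun r _ => (hz_pos p x σ r).le)
        (Finset.mem_Ico.2 ⟨hle.2, by omega⟩)
    have hUn := hU (Fin.ofNat (T+1) σ.1)
    rcases hs with ⟨hf, hs⟩ | ⟨hf, hs⟩
    · rw [hs]
      dsimp only
      have hnear : ∀ c, |((⌊(cnt x 0 (t+1) c : ℝ) + p.sg * Nz p (σ.1+1) ω c⌋₊ : ℕ) : ℝ) - cnt x 0 (t+1) c| ≤ e (σ.1+1) + 1 :=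
        fun c => floor_near _ _ _ (hω (σ.1+1) (by omega) (by omega) c)
      have ej1 := he (σ.1+1)
      refine ⟨⟨hnear, ?_⟩, fun i => ?_⟩
      · have h1 : Gz p x σ (t+1) ≤ 1 - b := hf.trans hUn.2
        unfold Gz at h1
        rw [div_le_iff₀ (by linarith)] at h1
        have h2 : b ≤ Hz p x σ (t+1) := by nlinarith
        have h3 : Real.exp (-(p.e1 * B)) ≤ hz p x σ t := by
          rw [Real.exp_neg, inv_le_iff_one_le_mul₀ hexpB]
          have h4 : 1 ≤ T / b * hz p x σ t := by
            rw [div_mul_eq_mul_div, le_div_iff₀ hb]; linarith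
          have := hz_pos p x σ t
          nlinarith
        unfold hz at h3
        rw [Real.exp_le_exp] at h3
        have h4 : p.Dl σ.1 - B ≤ Fq p x σ.2.1 σ.2.2 (t+1) := by
          by_contra hn
          push Not at hn
          nlinarith
        obtain ⟨i, hi⟩ := exists_eq_ciSup_of_finite (f := fun i => p.q i (fun c => σ.2.2 c + cnt x σ.2.1 (t+1) c) - p.q i σ.2.2)
        have h5 : Fq p x σ.2.1 σ.2.2 (t+1) = p.q i (fun c => σ.2.2 c + cnt x σ.2.1 (t+1) c) - p.q i σ.2.2 := hi.symm
        rw [h5, hDl] at h4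
        have n1 := abs_le.1 (near1 i)
        have n2 := abs_le.1 (near2 i)
        have h6 : 1 ≤ p.q i (cnt x 0 (t+1)) - p.q i (cnt x 0 σ.2.1) := by linarith [n1.1, n1.2, n2.1, n2.2]
        have h7 : ∑ i, (p.q i (cnt x 0 (t+1)) - p.q i (cnt x 0 σ.2.1)) ≥ p.q i (cnt x 0 (t+1)) - p.q i (cnt x 0 σ.2.1) :=
          Finset.single_le_sum (f := fun i => p.q i (cnt x 0 (t+1)) - p.q i (cnt x 0 σ.2.1))
            (fun i _ => sub_nonneg.2 ((hq i).2.2.1 _ _ fun c => cnt_mono x 0 _ _ (by omega) c)) (Finset.mem_univ i)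
        rw [Finset.sum_sub_distrib] at h7
        push_cast
        linarith
      · have := q_lip _ (hq i) _ (by linarith) _ _ hnear
        linarith
    · rw [hs]
      refine ⟨⟨ih1, ih2⟩, fun i => ?_⟩
      have h1 : b < Gz p x σ (t+1) := hUn.1.trans_lt hf
      unfold Gz at h1
      rw [lt_div_iff₀ (by linarith)] at h1
      have h2 : Hz p x σ (t+1) ≤ 1 / b := by
        rw [le_div_iff₀ hb]; nlinarith
      have h3 : hz p x σ t ≤ Real.exp (p.e1 * B) := hHt2.trans (h2.trans hB1)
      unfold hz at h3
      rw [Real.exp_le_exp] at h3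
      have h4 : Fq p x σ.2.1 σ.2.2 (t+1) ≤ p.Dl σ.1 + B := by
        by_contra hn
        push Not at hn
        nlinarith
      rw [hDl] at h4
      have h5 := le_Fq p x σ.2.1 σ.2.2 (t+1) i
      have h6 := (hq i).2.2.1 σ.2.2 (fun c => σ.2.2 c + cnt x σ.2.1 (t+1) c) (fun c => Nat.le_add_right _ _)
      have n2 := abs_le.1 (near2 i)
      rw [abs_le]; constructor <;> linarith [n2.1, n2.2]

lemma Pim_bad (n : Fin (T+1)) (b : ℝ) (hb : 0 < b) :
    Pim T {U | ¬ (b ≤ U n ∧ U n ≤ 1 - b)} ≤ ENNReal.ofReal (2*b) := by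
  have hs : {U : Fin (T+1) → ℝ | ¬ (b ≤ U n ∧ U n ≤ 1 - b)} = (Function.eval n) ⁻¹' {u : ℝ | ¬ (b ≤ u ∧ u ≤ 1 - b)} := rfl
  have hms : MeasurableSet {u : ℝ | ¬ (b ≤ u ∧ u ≤ 1 - b)} :=
    ((measurableSet_le measurable_const measurable_id).inter (measurableSet_le measurable_id measurable_const)).compl
  have hmp := measurePreserving_eval (fun _ : Fin (T+1) => Pu) n
  rw [hs]
  unfold Pim
  rw [hmp.measure_preimage hms.nullMeasurableSet]
  unfold Pu
  rw [Measure.restrict_apply hms]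
  calc _ ≤ volume (Set.Ico 0 b ∪ Set.Ioc (1-b) 1) := by
        apply measure_mono
        rintro u ⟨h1, h2⟩
        simp only [Set.mem_setOf_eq, not_and_or, not_le] at h1
        simp only [Set.mem_Ico] at h2
        rcases h1 with h1 | h1
        · left; exact ⟨h2.1, h1⟩
        · right; exact ⟨h1, h2.2.le⟩
    _ ≤ volume (Set.Ico 0 b) + volume (Set.Ioc (1-b) 1) := measure_union_le _ _
    _ = _ := by
        rw [Real.volume_Ico, Real.volume_Ioc, ← ENNReal.ofReal_add (by linarith) (by linarith)]
        congr 1; ring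

lemma Nz_tail (p : Par d k K) (j : ℕ) (c : Fin d) (V r : ℝ) (hV : 0 < V) (hD : ∑ κ, p.D j κ ^ 2 ≤ V) (hr : 0 ≤ r) :
    gm (Fin d × K) {ω | r < |Nz p j ω c|} ≤ 2 * ENNReal.ofReal (Real.exp (-(r^2/(2*V)))) := by
  set w : Fin d × K → ℝ := fun ck => if ck.1 = c then p.D j ck.2 else 0 with hw
  have h1 : ∀ ω, Nz p j ω c = dotp w ω := by
    intro ω
    unfold dotp Nz
    rw [Fintype.sum_prod_type, Finset.sum_eq_single c]
    · simp [hw]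
    · intro b _ hb; simp [hw, hb]
    · simp
  simp only [h1]
  apply gm_tail w V r hV _ hr
  rw [← h1]
  unfold Nz
  refine le_trans (le_of_eq ?_) hD
  simp [hw, sq]
end mech

open MeasureTheory

section mech
set_option linter.all false
variable {d k T : ℕ} {K : Type} [Fintype K]

noncomputable def ev (sg β : ℝ) (d : ℕ) (j : ℕ) : ℝ :=
  if j = 0 then 0 else sg * (((Nat.log 2 j : ℝ) + 1) * Real.sqrt (4 * Real.log (8 * d * j^2 / β)))

lemma ev_nonneg (sg β : ℝ) (d j : ℕ) (hsg : 0 < sg) : 0 ≤ ev sg β d j := by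
  unfold ev; split_ifs
  · exact le_rfl
  · positivity

lemma noise_bad (p : Par d k K) (hsg : 0 < p.sg) (hd : 1 ≤ d) (β : ℝ) (hβ : 0 < β) (hβ1 : β < 1) (j : ℕ) (hj : 1 ≤ j)
    (hD : ∑ κ, p.D j κ ^ 2 ≤ 2 * ((Nat.log 2 j : ℝ) + 1)^2) (c : Fin d) :
    gm (Fin d × K) {ω | ¬ |p.sg * Nz p j ω c| ≤ ev p.sg β d j} ≤ ENNReal.ofReal (β / (4 * d * j^2)) := by
  have hd' : (1:ℝ) ≤ d := by exact_mod_cast hd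
  have hj' : (1:ℝ) ≤ j := by exact_mod_cast hj
  have hj2 : (1:ℝ) ≤ (j:ℝ)^2 := one_le_pow₀ hj'
  have hA : (1:ℝ) ≤ 8 * d * j^2 / β := by
    rw [le_div_iff₀ hβ]; nlinarith
  set L := Real.log (8 * d * j^2 / β) with hL
  have hL0 : 0 ≤ L := Real.log_nonneg hA
  set m : ℝ := (Nat.log 2 j : ℝ) + 1 with hm
  have hm0 : 0 < m := by positivity
  have h := Nz_tail p j c (2 * m^2) (m * Real.sqrt (4 * L)) (by positivity) hD (by positivity)
  have e1 : (m * Real.sqrt (4 * L))^2 / (2 * (2 * m^2)) = L := by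
    rw [mul_pow, Real.sq_sqrt (by positivity)]; field_simp; ring
  rw [e1, Real.exp_neg, hL, Real.exp_log (by positivity)] at h
  have e2 : {ω | ¬ |p.sg * Nz p j ω c| ≤ ev p.sg β d j} = {ω | m * Real.sqrt (4 * L) < |Nz p j ω c|} := by
    ext ω
    simp only [Set.mem_setOf_eq, not_le, ev, if_neg (show ¬ j = 0 by omega)]
    rw [abs_mul, abs_of_pos hsg, mul_lt_mul_iff_right₀ hsg]
  rw [e2]
  refine h.trans (le_of_eq ?_)
  rw [show (2:ENNReal) = ENNReal.ofReal 2 by simp, ← ENNReal.ofReal_mul (by norm_num)]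
  congr 1
  field_simp; norm_num

lemma good (p : Par d k K) (hsg : 0 < p.sg) (hd : 1 ≤ d) (hT : 1 ≤ T) (β : ℝ) (hβ : 0 < β) (hβ1 : β < 1)
    (hD : ∀ j, 1 ≤ j → j ≤ T → ∑ κ, p.D j κ ^ 2 ≤ 2 * ((Nat.log 2 j : ℝ) + 1)^2)
    (A : Set ((Fin (T+1) → ℝ) × (Fin d × K → ℝ)))
    (hA : ∀ z : (Fin (T+1) → ℝ) × (Fin d × K → ℝ), (∀ n, β/(4*(T+1)) ≤ z.1 n ∧ z.1 n ≤ 1 - β/(4*(T+1))) →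
      (∀ j, 1 ≤ j → j ≤ T → ∀ c, |p.sg * Nz p j z.2 c| ≤ ev p.sg β d j) → z ∈ A) :
    ENNReal.ofReal (1 - β) ≤ Mu T d K A := by
  have hd' : (1:ℝ) ≤ d := by exact_mod_cast hd
  set b := β/(4*((T:ℝ)+1)) with hb
  have hb0 : 0 < b := by positivity
  have hsub : Aᶜ ⊆ (⋃ n : Fin (T+1), Prod.fst ⁻¹' {U | ¬ (b ≤ U n ∧ U n ≤ 1 - b)}) ∪
      (⋃ l ∈ Finset.range T, ⋃ c : Fin d, Prod.snd ⁻¹' {ω | ¬ |p.sg * Nz p (l+1) ω c| ≤ ev p.sg β d (l+1)}) := by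
    intro z hz
    by_contra hn
    apply hz
    simp only [Set.mem_union, Set.mem_iUnion, Set.mem_preimage, Set.mem_setOf_eq, not_or, not_exists, not_not] at hn
    refine hA z hn.1 fun j h1 h2 c => ?_
    have := hn.2 (j-1) (Finset.mem_range.2 (by omega)) c
    rwa [show j - 1 + 1 = j by omega] at this
  have hm1 : ∀ n : Fin (T+1), Mu T d K (Prod.fst ⁻¹' {U | ¬ (b ≤ U n ∧ U n ≤ 1 - b)}) ≤ ENNReal.ofReal (2*b) := by
    intro n
    have : (Prod.fst ⁻¹' {U | ¬ (b ≤ U n ∧ U n ≤ 1 - b)} : Set ((Fin (T+1) → ℝ) × (Fin d × K → ℝ))) =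
      {U | ¬ (b ≤ U n ∧ U n ≤ 1 - b)} ×ˢ Set.univ := by ext z; simp
    rw [this, Mu, Measure.prod_prod, measure_univ, mul_one]
    exact Pim_bad n b hb0
  have hm2 : ∀ l ∈ Finset.range T, ∀ c : Fin d, Mu T d K (Prod.snd ⁻¹' {ω | ¬ |p.sg * Nz p (l+1) ω c| ≤ ev p.sg β d (l+1)})
      ≤ ENNReal.ofReal (β / (4 * d * ((l+1 : ℕ):ℝ)^2)) := by
    intro l hl c
    have hl := Finset.mem_range.1 hl
    have : (Prod.snd ⁻¹' {ω | ¬ |p.sg * Nz p (l+1) ω c| ≤ ev p.sg β d (l+1)} : Set ((Fin (T+1) → ℝ) × (Fin d × K → ℝ))) =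
      Set.univ ×ˢ {ω | ¬ |p.sg * Nz p (l+1) ω c| ≤ ev p.sg β d (l+1)} := by ext z; simp
    rw [this, Mu, Measure.prod_prod, measure_univ, one_mul]
    exact noise_bad p hsg hd β hβ hβ1 (l+1) (by omega) (hD _ (by omega) (by omega)) c
  have hbad : Mu T d K Aᶜ ≤ ENNReal.ofReal β := by
    refine (measure_mono hsub).trans ((measure_union_le _ _).trans ?_)
    have h1 : Mu T d K (⋃ n : Fin (T+1), Prod.fst ⁻¹' {U | ¬ (b ≤ U n ∧ U n ≤ 1 - b)}) ≤ ENNReal.ofReal (β/2) := by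
      calc _ ≤ ∑ n : Fin (T+1), Mu T d K (Prod.fst ⁻¹' {U | ¬ (b ≤ U n ∧ U n ≤ 1 - b)}) := measure_iUnion_fintype_le _ _
        _ ≤ ∑ n : Fin (T+1), ENNReal.ofReal (2*b) := Finset.sum_le_sum fun n _ => hm1 n
        _ = _ := by
          rw [← ENNReal.ofReal_sum_of_nonneg (fun _ _ => by positivity)]
          congr 1
          rw [Finset.sum_const, Finset.card_univ, Fintype.card_fin, nsmul_eq_mul, hb]
          push_cast; field_simp; norm_num
    have h2 : Mu T d K (⋃ l ∈ Finset.range T, ⋃ c : Fin d, Prod.snd ⁻¹' {ω | ¬ |p.sg * Nz p (l+1) ω c| ≤ ev p.sg β d (l+1)}) ≤ ENNReal.ofReal (β/2) := by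
      calc _ ≤ ∑ l ∈ Finset.range T, Mu T d K (⋃ c : Fin d, Prod.snd ⁻¹' {ω | ¬ |p.sg * Nz p (l+1) ω c| ≤ ev p.sg β d (l+1)}) := measure_biUnion_finset_le _ _
        _ ≤ ∑ l ∈ Finset.range T, ∑ c : Fin d, Mu T d K (Prod.snd ⁻¹' {ω | ¬ |p.sg * Nz p (l+1) ω c| ≤ ev p.sg β d (l+1)}) :=
          Finset.sum_le_sum fun l _ => measure_iUnion_fintype_le _ _
        _ ≤ ∑ l ∈ Finset.range T, ∑ c : Fin d, ENNReal.ofReal (β / (4 * d * ((l+1 : ℕ):ℝ)^2)) :=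
          Finset.sum_le_sum fun l hl => Finset.sum_le_sum fun c _ => hm2 l hl c
        _ = ENNReal.ofReal (∑ l ∈ Finset.range T, ∑ c : Fin d, (β / (4 * d * ((l+1 : ℕ):ℝ)^2))) := by
          rw [ENNReal.ofReal_sum_of_nonneg (fun _ _ => by positivity)]
          refine Finset.sum_congr rfl fun l _ => ?_
          rw [ENNReal.ofReal_sum_of_nonneg (fun _ _ => by positivity)]
        _ ≤ _ := by
          apply ENNReal.ofReal_le_ofReal
          have e : ∀ l : ℕ, ∑ c : Fin d, (β / (4 * d * ((l+1 : ℕ):ℝ)^2)) = β/4 * (1 / ((l:ℝ)+1)^2) := by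
            intro l
            rw [Finset.sum_const, Finset.card_univ, Fintype.card_fin, nsmul_eq_mul]
            push_cast; field_simp
          simp only [e]
          rw [← Finset.mul_sum]
          have := sum_inv_sq T
          have hT0 : (0:ℝ) ≤ 1/(T:ℝ) := by positivity
          nlinarith
    calc _ ≤ ENNReal.ofReal (β/2) + ENNReal.ofReal (β/2) := add_le_add h1 h2
      _ = _ := by rw [← ENNReal.ofReal_add (by positivity) (by positivity)]; congr 1; ring
  have h1 : (1:ENNReal) ≤ Mu T d K A + Mu T d K Aᶜ := by
    rw [← measure_univ (μ := Mu T d K), ← Set.union_compl_self A]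
    exact measure_union_le _ _
  rw [ENNReal.ofReal_sub _ hβ.le, ENNReal.ofReal_one, tsub_le_iff_right]
  exact h1.trans (add_le_add le_rfl hbad)

end mech

lemma log2c_ge_one (z : ℝ) : 1 ≤ log2c z := by
  unfold log2c
  rw [Real.le_logb_iff_rpow_le (by norm_num) (by positivity)]; simp

lemma log_le_log2c (z a : ℝ) (n : ℕ) (ha : 0 < a) (h : a ≤ max z 2 ^ n) : Real.log a ≤ n * log2c z := by
  have hy : (2:ℝ) ≤ max z 2 := le_max_right _ _
  have h1 : Real.log a ≤ n * Real.log (max z 2) := by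
    rw [← Real.log_pow]; exact Real.log_le_log ha h
  have h2 : Real.log (max z 2) ≤ log2c z := by
    unfold log2c Real.logb
    rw [le_div_iff₀ (Real.log_pos (by norm_num))]
    have h3 : Real.log 2 ≤ 1 := by linarith [Real.log_two_lt_d9]
    have h4 : 0 ≤ Real.log (max z 2) := Real.log_nonneg (by linarith)
    nlinarith
  exact h1.trans (by gcongr)

lemma ev_bound (sg β z : ℝ) (d j : ℕ) (hsg : 0 < sg) (hβ : 0 < β) (hβ1 : β < 1) (hd : 1 ≤ d)
    (hz : (d:ℝ) * j / β ≤ z) : ev sg β d j ≤ sg * (10 * log2c z ^ ((3:ℝ)/2)) := by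
  have hl := log2c_ge_one z
  have hd' : (1:ℝ) ≤ d := by exact_mod_cast hd
  unfold ev
  split_ifs with h0
  · positivity
  have hj' : (1:ℝ) ≤ j := by exact_mod_cast (show 1 ≤ j by omega)
  have hy : (2:ℝ) ≤ max z 2 := le_max_right _ _
  have hzy : (d:ℝ) * j / β ≤ max z 2 := hz.trans (le_max_left _ _)
  have hjy : (j:ℝ) ≤ max z 2 := by
    refine le_trans ?_ hzy
    rw [le_div_iff₀ hβ]; nlinarith
  set y := max z 2 with hyd
  have h1 : Real.log (8 * d * j^2 / β) ≤ 5 * log2c z := by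
    have := log_le_log2c z (8 * d * j^2 / β) 5 (by positivity) (by
      rw [← hyd]
      calc 8 * (d:ℝ) * j^2 / β = 2^3 * (d * j / β) * j := by ring
        _ ≤ y^3 * y * y := by gcongr
        _ = y^5 := by ring)
    exact_mod_cast this
  have h2 : ((Nat.log 2 j : ℕ) : ℝ) ≤ log2c z := by
    unfold log2c
    rw [Real.le_logb_iff_rpow_le (by norm_num) (by positivity), Real.rpow_natCast]
    refine le_trans ?_ hjy
    exact_mod_cast Nat.pow_log_le_self 2 h0
  have h3 : Real.sqrt (4 * Real.log (8 * d * j^2 / β)) ≤ 5 * Real.sqrt (log2c z) := by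
    rw [Real.sqrt_le_left (by positivity), mul_pow, Real.sq_sqrt (by linarith)]
    linarith
  have h4 : log2c z ^ ((3:ℝ)/2) = log2c z * Real.sqrt (log2c z) := by
    rw [Real.sqrt_eq_rpow, ← Real.rpow_one_add' (by linarith) (by norm_num)]; norm_num
  rw [h4]
  have hs0 := Real.sqrt_nonneg (log2c z)
  refine mul_le_mul_of_nonneg_left ?_ hsg.le
  calc ((Nat.log 2 j : ℝ) + 1) * Real.sqrt (4 * Real.log (8 * d * j^2 / β)) ≤ (2 * log2c z) * (5 * Real.sqrt (log2c z)) := by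
        gcongr; linarith
    _ = _ := by ring

theorem histogram_queries_eps_delta_dp :
    ∃ C : ℝ, 0 < C ∧
      ∀ (ε δ β : ℝ) (d k T : ℕ),
        ε ∈ Set.Ioo (0 : ℝ) 1 → δ ∈ Set.Ioo (0 : ℝ) 1 → β ∈ Set.Ioo (0 : ℝ) 1 →
        1 ≤ d → 1 ≤ k → 1 ≤ T →
        ∀ q : Fin k → (Fin d → ℕ) → ℝ, (∀ i, MonotoneHistQuery (q i)) →
        ∃ M : (Fin T → Fin d → Bool) → Measure (Fin T → Fin k → ℝ),
          IsCOMech M ∧ IsEventDPApprox ε δ M ∧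
          ∀ x, ENNReal.ofReal (1 - β) ≤
            M x {a | ∀ (t : Fin T) (i : Fin k),
              |a t i - q i (hist x t)| ≤
                C * ε⁻¹ * log2c (1 / δ) *
                  (Real.sqrt d * (log2c ((d : ℝ) * k * cmax q x / β)) ^ ((3 : ℝ) / 2)
                    + Real.sqrt k * log2c ((k : ℝ) * cmax q x / β)
                    + log2c ((T : ℝ) / β))} := by
  refine ⟨1000, by norm_num, ?_⟩
  rintro ε δ β d k T ⟨hε, hε1⟩ ⟨hδ, hδ1⟩ ⟨hβ, hβ1⟩ hd hk hT q hq
  obtain ⟨K, hK, D, W, hDW, hW, hD⟩ := tree T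
  have hd' : (1:ℝ) ≤ d := by exact_mod_cast hd
  have hk' : (1:ℝ) ≤ k := by exact_mod_cast hk
  have hT' : (1:ℝ) ≤ T := by exact_mod_cast hT
  have hΛ := log2c_ge_one (1/δ)
  have hΛδ : Real.exp (-log2c (1/δ)) ≤ δ := by
    have h := log_le_log2c (1/δ) (1/δ) 1 (by positivity) (by simp)
    rw [one_div, Real.log_inv] at h
    rw [← Real.le_log_iff_exp_le hδ]
    simp only [one_div]
    push_cast at h; linarith
  set Λ := log2c (1/δ) with hΛd
  set sg : ℝ := 10 * Real.sqrt d * Λ / ε with hsgd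
  have hsd : 1 ≤ Real.sqrt d := by rw [Real.one_le_sqrt]; exact hd'
  have hsg : 0 < sg := by positivity
  set b : ℝ := β/(4*((T:ℝ)+1)) with hb
  have hb0 : 0 < b := by positivity
  have hb1 : b < 1 := by rw [hb, div_lt_one (by positivity)]; linarith
  set B : ℝ := Real.log (T / b) / (ε/6) with hB
  let p : Par d k K := ⟨q, ε/6, sg, fun j => 2 * (ev sg β d j + 1) + B + 1, D⟩
  refine ⟨Mech p, Mech_CO p, ?_, ?_⟩
  · rintro x y ⟨t₀, hxy⟩ S hS
    have h := Mech_priv hk p (by show 0 ≤ ε/6; positivity) hq hsg W hDW hW (ε/2) (8*Λ/ε) (Real.exp (-Λ-1)) (by positivity) (by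
      show Real.exp (-(8*Λ/ε)*(ε/2) + (8*Λ/ε)*(1+8*Λ/ε)*(3*d/sg^2)/2) ≤ _
      apply Real.exp_le_exp.2
      have e1 : -(8*Λ/ε)*(ε/2) = -4*Λ := by field_simp; norm_num
      have e2 : 3*(d:ℝ)/sg^2 = 3*ε^2/(100*Λ^2) := by
        rw [hsgd, div_pow, mul_pow, mul_pow, Real.sq_sqrt (by positivity)]
        field_simp; norm_num
      have e3 : 1 ≤ 8*Λ/ε := by rw [le_div_iff₀ hε]; linarith
      have e4 : (8*Λ/ε)*(1+8*Λ/ε)*(3*d/sg^2)/2 ≤ 1.92 := by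
        calc (8*Λ/ε)*(1+8*Λ/ε)*(3*d/sg^2)/2 ≤ (8*Λ/ε)*(8*Λ/ε+8*Λ/ε)*(3*d/sg^2)/2 := by gcongr
          _ = 1.92 := by rw [e2]; field_simp; norm_num
      rw [e1]; norm_num at e4; linarith) x y t₀ hxy S hS
    refine h.trans ?_
    have e5 : Real.exp p.e1 ^ 3 = Real.exp (ε/2) := by
      show Real.exp (ε/6) ^ 3 = _
      rw [← Real.exp_nat_mul]; congr 1; push_cast; ring
    rw [e5, mul_add, ← mul_assoc, ← ENNReal.ofReal_mul (by positivity), ← ENNReal.ofReal_mul (by positivity),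
      ← Real.exp_add, ← Real.exp_add]
    refine add_le_add ?_ ?_
    · rw [show ε/2+ε/2 = ε by ring]
    · apply ENNReal.ofReal_le_ofReal
      refine le_trans (Real.exp_le_exp.2 ?_) hΛδ
      linarith
  · intro x
    refine le_trans ?_ (Measure.le_map_apply (outp_meas p x).aemeasurable _)
    refine good p hsg hd hT β hβ hβ1 hD _ fun z hz1 hz2 => ?_
    rw [Set.mem_preimage, Set.mem_ofPred_eq]
    intro t i
    have hTb : 0 < (T:ℝ)/b := by positivity
    obtain ⟨⟨-, h2⟩, h3⟩ := path hk hT p hq (by show 0 < ε/6; positivity) (fun j => ev sg β d j) (fun j => ev_nonneg sg β d j hsg) b B hb0 hb1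
      (by
        show (T:ℝ)/b ≤ Real.exp (ε/6 * (Real.log (T / b) / (ε/6)))
        rw [mul_div_cancel₀ _ (by positivity), Real.exp_log hTb]) (fun j => rfl) x z.1 z.2 hz1 hz2 (t.val+1) t.isLt
    have h3 := h3 i
    rw [← hist_eq] at h3
    refine le_trans h3 ?_
    have hle := st_le p x z.1 z.2 (t.val+1)
    set σ := st p x z.1 z.2 (t.val+1) with hσ
    have hcm : (σ.1 : ℝ) ≤ k * cmax q x := by
      refine h2.trans ?_
      calc _ ≤ ∑ i : Fin k, cmax q x := by
            refine Finset.sum_le_sum fun i _ => ?_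
            have a1 : p.q i (cnt x 0 σ.2.1) ≤ q i (hist x t) := by
              rw [hist_eq]
              exact (hq i).2.2.1 _ _ fun c => cnt_mono x 0 _ _ hle.2 c
            have a2 : q i (hist x t) ≤ ⨆ t : Fin T, q i (hist x t) :=
              le_ciSup (f := fun t => q i (hist x t)) (Set.finite_range _).bddAbove t
            have a3 : (⨆ t : Fin T, q i (hist x t)) ≤ cmax q x :=
              le_ciSup (f := fun i => ⨆ t : Fin T, q i (hist x t)) (Set.finite_range _).bddAbove i
            exact a1.trans (a2.trans a3)
        _ = _ := by rw [Finset.sum_const, Finset.card_univ, Fintype.card_fin, nsmul_eq_mul]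
    have hev := ev_bound sg β ((d:ℝ) * k * cmax q x / β) d σ.1 hsg hβ hβ1 hd (by
      rw [mul_assoc]; gcongr)
    have hl2 := log2c_ge_one ((k : ℝ) * cmax q x / β)
    have hl1 := log2c_ge_one ((d:ℝ) * k * cmax q x / β)
    have hl3 := log2c_ge_one ((T:ℝ) / β)
    have hBb : B ≤ 30 * log2c ((T:ℝ) / β) / ε := by
      have hlog := log_le_log2c ((T:ℝ)/β) (T/b) 5 hTb (by
        have hy : (2:ℝ) ≤ max ((T:ℝ)/β) 2 := le_max_right _ _
        have hy2 : (T:ℝ)/β ≤ max ((T:ℝ)/β) 2 := le_max_left _ _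
        have hy3 : (T:ℝ) ≤ max ((T:ℝ)/β) 2 := by
          refine le_trans ?_ hy2
          rw [le_div_iff₀ hβ]; nlinarith
        set y := max ((T:ℝ)/β) 2
        calc (T:ℝ)/b = 4 * (T/β) * (T+1) := by rw [hb]; field_simp
          _ ≤ 4 * (T/β) * (T+T) := by gcongr
          _ = 2^3 * (T/β) * T := by ring
          _ ≤ y^3 * y * y := by gcongr
          _ = y^5 := by ring)
      rw [hB]
      calc Real.log (T / b) / (ε/6) ≤ ((5:ℕ):ℝ) * log2c ((T:ℝ)/β) / (ε/6) := by gcongr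
        _ = _ := by push_cast; field_simp; norm_num
    set P := log2c ((d:ℝ) * k * cmax q x / β) ^ ((3:ℝ)/2) with hP
    have hP0 : 0 ≤ P := by positivity
    set l3 := log2c ((T:ℝ) / β) with hl3d
    set l2 := log2c ((k : ℝ) * cmax q x / β) with hl2d
    have f1 : ev sg β d σ.1 ≤ ε⁻¹ * Λ * (100 * (Real.sqrt d * P)) := by
      refine hev.trans (le_of_eq ?_)
      rw [hsgd]; field_simp; ring
    have hei : 1 ≤ ε⁻¹ := by rw [one_le_inv₀ hε]; exact hε1.le
    have heΛ : 1 ≤ ε⁻¹ * Λ := one_le_mul_of_one_le_of_one_le hei hΛ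
    have f2 : B ≤ ε⁻¹ * Λ * (30 * l3) := by
      refine hBb.trans ?_
      calc 30 * l3 / ε = ε⁻¹ * 1 * (30 * l3) := by field_simp
        _ ≤ _ := by gcongr
    have f3 : 1 ≤ ε⁻¹ * Λ * l3 := one_le_mul_of_one_le_of_one_le heΛ hl3
    have f4 : 0 ≤ ε⁻¹ * Λ * (Real.sqrt k * l2) := by positivity
    have f5 : 0 ≤ ε⁻¹ * Λ * (Real.sqrt d * P) := by positivity
    show 3 * (ev sg β d σ.1 + 1) + 2 * B + 1 ≤ _
    calc 3 * (ev sg β d σ.1 + 1) + 2 * B + 1 ≤ 1000 * (ε⁻¹ * Λ * (Real.sqrt d * P)) + 1000 * (ε⁻¹ * Λ * (Real.sqrt k * l2)) + 1000 * (ε⁻¹ * Λ * l3) := by linarith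
      _ = _ := by ring
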